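/- (Uniqueness and continuity of blow-ups at singular points.) Let u be a solution of the normalized obstacle problem on Ω and let x0 ∈ Σ be a singular point. Then there exists a (unique) polynomial p_{*,x0} ∈ 𝒫 such that u(x0 + r x)/r² → p_{*,x0}(x) locally uniformly on ℝⁿ as r → 0⁺ (the full limit, not merely along a subsequence). Moreover, the map Σ ∋ x0 ↦ p_{*,x0} (equivalently, the map sending x0 to the coefficient matrix A_{x0} with p_{*,x0}(x) = (1/2)⟨A_{x0}x, x⟩) is locally uniformly continuous on Σ. -/

import Mathlib

open MeasureTheory Filter Metric Set
open scoped NNReal ENNReal Topology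

noncomputable section

/-- The (pointwise a.e. defined) Laplacian of a `C^{1,1}_loc` function, as the
trace of the derivative of the gradient. -/
def lapGrad {n : ℕ} (w : EuclideanSpace ℝ (Fin n) → ℝ)
    (x : EuclideanSpace ℝ (Fin n)) : ℝ :=
  ∑ i : Fin n, fderiv ℝ (gradient w) x (EuclideanSpace.single i 1) i

/-- `u` is a solution of the normalized obstacle problem on `Ω`:
`u ∈ C^{1,1}_loc(Ω)`, `u ≥ 0`, and `Δu = χ_{{u>0}}` a.e. on `Ω`. -/
def IsObstacleSol {n : ℕ} (Ω : Set (EuclideanSpace ℝ (Fin n)))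
    (u : EuclideanSpace ℝ (Fin n) → ℝ) : Prop :=
  (∀ x ∈ Ω, DifferentiableAt ℝ u x) ∧
  (∀ K : Set (EuclideanSpace ℝ (Fin n)), K ⊆ Ω → IsCompact K →
    ∃ L : ℝ≥0, LipschitzOnWith L (gradient u) K) ∧
  (∀ x ∈ Ω, 0 ≤ u x) ∧
  (∀ᵐ x ∂(volume.restrict Ω), lapGrad u x = if 0 < u x then 1 else 0)

/-- The free boundary `∂{u > 0} ∩ Ω`. -/
def freeBoundary {n : ℕ} (Ω : Set (EuclideanSpace ℝ (Fin n)))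
    (u : EuclideanSpace ℝ (Fin n) → ℝ) : Set (EuclideanSpace ℝ (Fin n)) :=
  frontier {x | x ∈ Ω ∧ 0 < u x} ∩ Ω

/-- The quadratic polynomial `p(x) = (1/2)⟨Ax, x⟩` associated with a matrix `A`. -/
def quadForm {n : ℕ} (A : Matrix (Fin n) (Fin n) ℝ)
    (x : EuclideanSpace ℝ (Fin n)) : ℝ :=
  (1 / 2) * ∑ i, ∑ j, A i j * x i * x j

/-- `A` encodes an element of `𝒫`: a symmetric nonnegative-definite matrix of
trace `1`. -/
def MemP {n : ℕ} (A : Matrix (Fin n) (Fin n) ℝ) : Prop :=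
  A.PosSemidef ∧ A.trace = 1

/-- `x0` is a singular free boundary point: along some sequence `r_k → 0⁺` the
rescalings `u(x0 + r_k x)/r_k²` converge locally uniformly to some `p ∈ 𝒫`. -/
def IsSingularPt {n : ℕ} (Ω : Set (EuclideanSpace ℝ (Fin n)))
    (u : EuclideanSpace ℝ (Fin n) → ℝ) (x0 : EuclideanSpace ℝ (Fin n)) : Prop :=
  x0 ∈ freeBoundary Ω u ∧
  ∃ (r : ℕ → ℝ) (A : Matrix (Fin n) (Fin n) ℝ),
    (∀ k, 0 < r k) ∧ Tendsto r atTop (𝓝 0) ∧ MemP A ∧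
    TendstoLocallyUniformly (fun k x => u (x0 + r k • x) / r k ^ 2)
      (quadForm A) atTop

/-- `p(x) = (1/2)⟨Ax, x⟩ ∈ 𝒫` is the (full) blow-up of `u` at `x0`:
`u(x0 + r x)/r² → p(x)` locally uniformly as `r → 0⁺`. -/
def IsBlowup {n : ℕ} (u : EuclideanSpace ℝ (Fin n) → ℝ)
    (x0 : EuclideanSpace ℝ (Fin n)) (A : Matrix (Fin n) (Fin n) ℝ) : Prop :=
  MemP A ∧
  TendstoLocallyUniformly (fun (r : ℝ) x => u (x0 + r • x) / r ^ 2)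
    (quadForm A) (𝓝[>] 0)


section helpers


/-- Euclidean space. -/
abbrev EE (n : ℕ) := EuclideanSpace ℝ (Fin n)

/-- `C^{1,1}` on a ball, with constant `L`. -/
structure Reg {n : ℕ} (L : ℝ≥0) (c : EE n) (R : ℝ) (v : EE n → ℝ) : Prop where
  diff : ∀ x ∈ ball c R, DifferentiableAt ℝ v x
  lip : LipschitzOnWith L (gradient v) (ball c R)

/-- Weighted integrals over the unit ball. -/
def J {n : ℕ} (k : ℕ) (f : EE n → ℝ) : ℝ :=
  ∫ x in closedBall (0 : EE n) 1, (1 - ‖x‖ ^ 2) ^ k * f x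

/-- Weighted integrability over the unit ball. -/
def JI {n : ℕ} (k : ℕ) (f : EE n → ℝ) : Prop :=
  IntegrableOn (fun x => (1 - ‖x‖ ^ 2) ^ k * f x) (closedBall (0 : EE n) 1)

variable {n : ℕ}

lemma JI.of_cont {k : ℕ} {f : EE n → ℝ} (hf : ContinuousOn f (closedBall 0 1)) : JI k f := by
  apply ContinuousOn.integrableOn_compact (isCompact_closedBall _ _)
  fun_prop

lemma JI.add {k : ℕ} {f g : EE n → ℝ} (hf : JI k f) (hg : JI k g) : JI k (fun x => f x + g x) := by
  have := Integrable.add hf hg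
  refine this.congr (ae_of_all _ fun x => ?_)
  simp only [Pi.add_apply]; ring

lemma JI.smul {k : ℕ} {f : EE n → ℝ} (c : ℝ) (hf : JI k f) : JI k (fun x => c * f x) := by
  have := Integrable.const_mul hf c
  refine this.congr (ae_of_all _ fun x => ?_)
  simp only; ring

lemma JI.sub {k : ℕ} {f g : EE n → ℝ} (hf : JI k f) (hg : JI k g) : JI k (fun x => f x - g x) := by
  have := Integrable.sub hf hg
  refine this.congr (ae_of_all _ fun x => ?_)
  simp only [Pi.sub_apply]; ring

lemma J_add {k : ℕ} {f g : EE n → ℝ} (hf : JI k f) (hg : JI k g) :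
    J k (fun x => f x + g x) = J k f + J k g := by
  unfold J
  rw [← integral_add hf hg]
  congr 1; ext x; ring

lemma J_sub {k : ℕ} {f g : EE n → ℝ} (hf : JI k f) (hg : JI k g) :
    J k (fun x => f x - g x) = J k f - J k g := by
  unfold J
  rw [← integral_sub hf hg]
  congr 1; ext x; ring

lemma J_smul {k : ℕ} {f : EE n → ℝ} (c : ℝ) :
    J k (fun x => c * f x) = c * J k f := by
  unfold J
  rw [← integral_const_mul]
  congr 1; ext x; ring

lemma weight_nonneg {k : ℕ} {x : EE n} (hx : x ∈ closedBall (0 : EE n) 1) :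
    0 ≤ (1 - ‖x‖ ^ 2) ^ k := by
  apply pow_nonneg
  have : ‖x‖ ≤ 1 := by simpa using hx
  nlinarith [norm_nonneg x]

lemma weight_le_one {k : ℕ} {x : EE n} (hx : x ∈ closedBall (0 : EE n) 1) :
    (1 - ‖x‖ ^ 2) ^ k ≤ 1 := by
  have : ‖x‖ ≤ 1 := by simpa using hx
  apply pow_le_one₀
  · nlinarith [norm_nonneg x]
  · nlinarith [norm_nonneg x]

lemma J_mono_ae {k : ℕ} {f g : EE n → ℝ} (hf : JI k f) (hg : JI k g)
    (h : ∀ᵐ x, x ∈ closedBall (0 : EE n) 1 → f x ≤ g x) : J k f ≤ J k g := by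
  apply setIntegral_mono_on_ae hf hg measurableSet_closedBall
  filter_upwards [h] with x hx hxB
  exact mul_le_mul_of_nonneg_left (hx hxB) (weight_nonneg hxB)

lemma J_mono {k : ℕ} {f g : EE n → ℝ} (hf : JI k f) (hg : JI k g)
    (h : ∀ x, x ∈ closedBall (0 : EE n) 1 → f x ≤ g x) : J k f ≤ J k g :=
  J_mono_ae hf hg (ae_of_all _ h)

lemma J_nonneg_ae {k : ℕ} {f : EE n → ℝ}
    (h : ∀ᵐ x, x ∈ closedBall (0 : EE n) 1 → 0 ≤ f x) : 0 ≤ J k f := by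
  apply setIntegral_nonneg_of_ae_restrict
  rw [EventuallyLE, ae_restrict_iff' measurableSet_closedBall]
  filter_upwards [h] with x hx hxB
  exact mul_nonneg (weight_nonneg hxB) (hx hxB)

lemma J_nonneg {k : ℕ} {f : EE n → ℝ}
    (h : ∀ x, x ∈ closedBall (0 : EE n) 1 → 0 ≤ f x) : 0 ≤ J k f :=
  J_nonneg_ae (ae_of_all _ h)

lemma J_congr_ae {k : ℕ} {f g : EE n → ℝ}
    (h : ∀ᵐ x, x ∈ closedBall (0 : EE n) 1 → f x = g x) : J k f = J k g := by
  apply setIntegral_congr_ae measurableSet_closedBall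
  filter_upwards [h] with x hx hxB
  rw [hx hxB]

lemma J_congr {k : ℕ} {f g : EE n → ℝ}
    (h : ∀ x, x ∈ closedBall (0 : EE n) 1 → f x = g x) : J k f = J k g :=
  J_congr_ae (ae_of_all _ h)

lemma JI.congr_ae {k : ℕ} {f g : EE n → ℝ} (hf : JI k f)
    (h : ∀ᵐ x, x ∈ closedBall (0 : EE n) 1 → f x = g x) : JI k g := by
  refine Integrable.congr hf ?_
  rw [EventuallyEq, ae_restrict_iff' measurableSet_closedBall]
  filter_upwards [h] with x hx hxB
  rw [hx hxB]

/-- total weight bound -/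
lemma J_abs_le {k : ℕ} {f : EE n → ℝ} {C : ℝ} (hf : JI k f)
    (h : ∀ x, x ∈ closedBall (0 : EE n) 1 → |f x| ≤ C) : |J k f| ≤ C * J k (fun _ : EE n => 1) := by
  have h1 : JI k (fun _ : EE n => (1:ℝ)) := JI.of_cont (by fun_prop)
  rw [abs_le]
  constructor
  · have := J_mono (k := k) (h1.smul (-C)) hf (fun x hx => by have := (abs_le.1 (h x hx)).1; linarith)
    rw [J_smul] at this; linarith
  · have := J_mono (k := k) hf (h1.smul C) (fun x hx => by have := (abs_le.1 (h x hx)).2; linarith)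
    rw [J_smul] at this; linarith

lemma J_one_pos (k : ℕ) : 0 < J k (fun _ : EE n => (1:ℝ)) := by
  have hb : ball (0 : EE n) (1/2) ⊆ closedBall 0 1 := ball_subset_closedBall.trans (closedBall_subset_closedBall (by norm_num))
  have h1 : JI k (fun _ : EE n => (1:ℝ)) := JI.of_cont (by fun_prop)
  have : ∫ x in ball (0 : EE n) (1/2), ((3/4:ℝ)^k) ≤ J k (fun _ : EE n => (1:ℝ)) := by
    calc ∫ x in ball (0 : EE n) (1/2), ((3/4:ℝ)^k)
        ≤ ∫ x in ball (0 : EE n) (1/2), (1 - ‖x‖ ^ 2) ^ k * 1 := by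
          apply setIntegral_mono_on _ (h1.mono_set hb) measurableSet_ball
          · intro x hx
            have : ‖x‖ < 1/2 := by simpa using hx
            rw [mul_one]
            apply pow_le_pow_left₀ (by norm_num)
            nlinarith [norm_nonneg x]
          · exact (integrableOn_const (measure_ball_lt_top.ne))
      _ ≤ _ := by
          apply setIntegral_mono_set h1
          · rw [EventuallyLE, ae_restrict_iff' measurableSet_closedBall]
            exact ae_of_all _ fun x hx => by simpa using weight_nonneg hx
          · exact hb.eventuallyLE
  refine lt_of_lt_of_le ?_ this
  rw [setIntegral_const, smul_eq_mul]
  apply mul_pos _ (by positivity)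
  apply ENNReal.toReal_pos (measure_ball_pos _ _ (by norm_num)).ne' measure_ball_lt_top.ne

namespace Reg
variable {L : ℝ≥0} {c : EE n} {R : ℝ} {v : EE n → ℝ}

lemma mono {L' : ℝ≥0} {R' : ℝ} (h : Reg L c R v) (hL : L ≤ L') (hR : R' ≤ R) : Reg L' c R' v :=
  ⟨fun x hx => h.diff x (ball_subset_ball hR hx), (h.lip.mono (ball_subset_ball hR)).weaken hL⟩

lemma cont (h : Reg L c R v) : ContinuousOn v (ball c R) :=
  fun x hx => (h.diff x hx).continuousAt.continuousWithinAt

lemma gcont (h : Reg L c R v) : ContinuousOn (gradient v) (ball c R) := h.lip.continuousOn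

lemma taylor (h : Reg L c R v) {x y : EE n} (hx : x ∈ ball c R) (hy : y ∈ ball c R) :
    |v y - v x - inner ℝ (gradient v x) (y - x)| ≤ L * ‖y - x‖ ^ 2 := by
  have hs : Convex ℝ (ball c R ∩ closedBall x ‖y - x‖) :=
    (convex_ball _ _).inter (convex_closedBall _ _)
  have key := hs.norm_image_sub_le_of_norm_hasFDerivWithin_le' (f := v) (f' := fderiv ℝ v)
    (C := L * ‖y - x‖) (x := x) (y := y) (φ := fderiv ℝ v x)
    (fun z hz => (h.diff z hz.1).hasFDerivAt.hasFDerivWithinAt)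
    (fun z hz => by
      have h1 := h.lip.dist_le_mul z hz.1 x hx
      rw [dist_eq_norm, dist_eq_norm] at h1
      have h2 : ‖fderiv ℝ v z - fderiv ℝ v x‖ = ‖gradient v z - gradient v x‖ := by
        rw [← toDual_gradient, ← toDual_gradient, ← map_sub, LinearIsometryEquiv.norm_map]
      rw [h2]
      refine h1.trans ?_
      gcongr
      have := hz.2
      rwa [mem_closedBall, dist_eq_norm] at this)
    ⟨hx, by simp⟩ ⟨hy, by simp [dist_eq_norm]⟩
  rw [inner_gradient_left, ← Real.norm_eq_abs]
  calc _ ≤ _ := key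
    _ = _ := by ring

lemma lipschitz (h : Reg L c R v) : ∃ K : ℝ≥0, LipschitzOnWith K v (ball c R) := by
  rcases le_or_gt R 0 with hR | hR
  · exact ⟨0, by rw [ball_eq_empty.2 hR]; simp [LipschitzOnWith]⟩
  have hc : c ∈ ball c R := by simpa using hR
  refine ⟨(‖gradient v c‖ + L * R).toNNReal, ?_⟩
  apply (convex_ball c R).lipschitzOnWith_of_nnnorm_fderiv_le (fun x hx => h.diff x hx)
  intro x hx
  rw [← NNReal.coe_le_coe]
  rw [Real.coe_toNNReal _ (by positivity), coe_nnnorm]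
  rw [← toDual_gradient, LinearIsometryEquiv.norm_map]
  have h1 := h.lip.dist_le_mul x hx c hc
  rw [dist_eq_norm, dist_eq_norm] at h1
  have h2 : ‖x - c‖ ≤ R := by have := mem_ball.1 hx; rw [dist_eq_norm] at this; exact this.le
  calc ‖gradient v x‖ = ‖gradient v c + (gradient v x - gradient v c)‖ := by congr 1; abel
    _ ≤ ‖gradient v c‖ + ‖gradient v x - gradient v c‖ := norm_add_le _ _
    _ ≤ _ := by gcongr; exact h1.trans (by gcongr)

end Reg

lemma closedBall_sub_ball2 : closedBall (0 : EE n) 1 ⊆ ball 0 2 := closedBall_subset_ball (by norm_num)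

/-- A Lipschitz function on a ball vanishing outside the unit ball is globally Lipschitz. -/
lemma lip_glob {f : EE n → ℝ} {K : ℝ≥0} {R : ℝ} (hR : 2 ≤ R) (hf : LipschitzOnWith K f (ball 0 R))
    (h0 : ∀ x, 1 < ‖x‖ → f x = 0) : ∃ K' : ℝ≥0, LipschitzWith K' f := by
  have hmem0 : (0 : EE n) ∈ ball (0 : EE n) R := by simp; linarith
  have hb : ∀ x, ‖x‖ ≤ 1 → |f x| ≤ |f 0| + K := by
    intro x hx
    have h1 := hf.dist_le_mul x (by simp; linarith) 0 hmem0
    rw [Real.dist_eq, dist_zero_right] at h1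
    have := abs_sub_abs_le_abs_sub (f x) (f 0)
    have : (K : ℝ) * ‖x‖ ≤ K := mul_le_of_le_one_right K.2 hx
    linarith
  have key : ∀ x y, ‖x‖ ≤ 1 → dist (f x) (f y) ≤ (|f 0| + K) * dist x y := by
    intro x y hx
    by_cases hy : ‖y‖ < R
    · refine (hf.dist_le_mul x (by simp; linarith) y (by simpa using hy)).trans ?_
      gcongr
      linarith [abs_nonneg (f 0)]
    · have hd : 1 ≤ dist x y := by
        rw [dist_eq_norm]
        have := norm_sub_norm_le y x
        rw [norm_sub_rev]; linarith
      rw [h0 y (by linarith), dist_zero_right, Real.norm_eq_abs]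
      refine (hb x hx).trans ?_
      exact le_mul_of_one_le_right (by positivity) hd
  refine ⟨(|f 0| + K).toNNReal, LipschitzWith.of_dist_le_mul fun x y => ?_⟩
  rw [Real.coe_toNNReal _ (by positivity)]
  by_cases hx : ‖x‖ ≤ 1
  · exact key x y hx
  by_cases hy : ‖y‖ ≤ 1
  · rw [dist_comm, dist_comm x y]; exact key y x hy
  · push Not at hx hy
    rw [h0 x hx, h0 y hy]; simp; positivity

lemma lip_mul {f g : EE n → ℝ} {K K' : ℝ≥0} {R : ℝ} (hR : 0 < R) (hf : LipschitzOnWith K f (ball 0 R))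
    (hg : LipschitzOnWith K' g (ball 0 R)) : ∃ M : ℝ≥0, LipschitzOnWith M (fun x => f x * g x) (ball 0 R) := by
  have hmem0 : (0 : EE n) ∈ ball (0 : EE n) R := by simpa using hR
  have hb : ∀ (f : EE n → ℝ) (K : ℝ≥0), LipschitzOnWith K f (ball 0 R) → ∀ x ∈ ball (0 : EE n) R, |f x| ≤ |f 0| + K * R := by
    intro f K hf x hx
    have h1 := hf.dist_le_mul x hx 0 hmem0
    rw [Real.dist_eq, dist_zero_right] at h1
    have := abs_sub_abs_le_abs_sub (f x) (f 0)
    have : (K : ℝ) * ‖x‖ ≤ K * R := by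
      gcongr; simp at hx; exact hx.le
    linarith
  refine ⟨((|f 0| + K * R) * K' + (|g 0| + K' * R) * K).toNNReal, LipschitzOnWith.of_dist_le_mul fun x hx y hy => ?_⟩
  rw [Real.coe_toNNReal _ (by positivity)]
  have h1 := hf.dist_le_mul x hx y hy
  have h2 := hg.dist_le_mul x hx y hy
  rw [Real.dist_eq] at *
  have : f x * g x - f y * g y = f x * (g x - g y) + g y * (f x - f y) := by ring
  rw [this]
  calc _ ≤ |f x| * |g x - g y| + |g y| * |f x - f y| := by
        rw [← abs_mul, ← abs_mul]; exact abs_add_le _ _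
    _ ≤ (|f 0| + K * R) * (K' * dist x y) + (|g 0| + K' * R) * (K * dist x y) := by
        gcongr
        · exact hb f K hf x hx
        · exact hb g K' hg y hy
    _ = _ := by ring


/-- truncated weight -/
def wt (k : ℕ) (x : EE n) : ℝ := (max (1 - ‖x‖ ^ 2) 0) ^ k

lemma wt_eq {k : ℕ} {x : EE n} (hx : x ∈ closedBall (0 : EE n) 1) : wt k x = (1 - ‖x‖ ^ 2) ^ k := by
  have : ‖x‖ ≤ 1 := by simpa using hx
  unfold wt
  rw [max_eq_left]
  nlinarith [norm_nonneg x]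

lemma wt_zero {k : ℕ} {x : EE n} (hx : 1 < ‖x‖) : wt (k+1) x = 0 := by
  unfold wt
  rw [max_eq_right, zero_pow (by omega)]
  nlinarith [norm_nonneg x]

lemma wt_lip_on (k : ℕ) : ∃ K : ℝ≥0, LipschitzOnWith K (wt (n := n) k) (ball 0 2) := by
  induction k with
  | zero => exact ⟨0, by simp [wt, LipschitzOnWith]⟩
  | succ k ih =>
    obtain ⟨K, hK⟩ := ih
    have h1 : LipschitzOnWith 4 (fun x : EE n => max (1 - ‖x‖ ^ 2) 0) (ball 0 2) := by
      refine LipschitzOnWith.of_dist_le_mul fun x hx y hy => ?_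
      rw [Real.dist_eq]
      refine (abs_max_sub_max_le_abs _ _ _).trans ?_
      have hx' : ‖x‖ < 2 := by simpa using hx
      have hy' : ‖y‖ < 2 := by simpa using hy
      have h3 : |‖x‖ - ‖y‖| ≤ dist x y := by rw [dist_eq_norm]; exact abs_norm_sub_norm_le x y
      have : 1 - ‖x‖ ^ 2 - (1 - ‖y‖ ^ 2) = -((‖x‖ + ‖y‖) * (‖x‖ - ‖y‖)) := by ring
      rw [this, abs_neg, abs_mul]
      rw [abs_of_nonneg (by positivity : 0 ≤ ‖x‖ + ‖y‖)]
      have h4 : ((4 : ℝ≥0) : ℝ) = 4 := by norm_num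
      rw [h4]
      gcongr
      linarith
    obtain ⟨M, hM⟩ := lip_mul (by norm_num) hK h1
    refine ⟨M, ?_⟩
    have he : (wt (n := n) (k+1)) = fun x => wt k x * max (1 - ‖x‖ ^ 2) 0 := by
      ext x; simp only [wt, pow_succ]
    rw [he]; exact hM

lemma ibp1 {k : ℕ} {h g : EE n → ℝ} {K K' : ℝ≥0} (hh : LipschitzOnWith K h (ball 0 2))
    (hg : LipschitzOnWith K' g (ball 0 2)) (i : Fin n) :
    JI (k+1) (fun x => g x * lineDeriv ℝ h x (EuclideanSpace.single i 1)) ∧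
    J (k+1) (fun x => h x * lineDeriv ℝ g x (EuclideanSpace.single i 1)) =
      - J (k+1) (fun x => g x * lineDeriv ℝ h x (EuclideanSpace.single i 1)) +
        2 * (k+1) * J k (fun x => x i * h x * g x) := by
  set e : EE n := EuclideanSpace.single i 1 with he
  obtain ⟨Kw, hKw⟩ := wt_lip_on (n := n) (k+1)
  obtain ⟨M, hM⟩ := lip_mul (by norm_num) hKw hh
  set F : EE n → ℝ := fun x => wt (k+1) x * h x with hF
  obtain ⟨M', hFL⟩ := lip_glob le_rfl hM (fun x hx => by rw [hF]; simp only [wt_zero hx, zero_mul])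
  obtain ⟨g', hg'L, hg'⟩ := hg.extend_real
  have hFc : HasCompactSupport F := by
    apply HasCompactSupport.of_support_subset_isCompact (isCompact_closedBall (0 : EE n) 1)
    intro x hx
    by_contra hc
    apply hx
    simp only [mem_closedBall, dist_zero_right, not_le] at hc
    simp [hF, wt_zero hc]
  have main := hg'L.integral_lineDeriv_mul_eq (μ := volume) hFL hFc e
  have hball : ball (0 : EE n) 2 ∈ 𝓝ˢ (closedBall (0 : EE n) 1) :=
    isOpen_ball.mem_nhdsSet.2 closedBall_sub_ball2
  -- LHS
  have lhs : ∫ x, lineDeriv ℝ g' x e * F x = J (k+1) (fun x => h x * lineDeriv ℝ g x e) := by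
    rw [← setIntegral_eq_integral_of_forall_compl_eq_zero (s := closedBall (0 : EE n) 1)]
    · unfold J
      apply setIntegral_congr_fun measurableSet_closedBall
      intro x hx
      have : g' =ᶠ[𝓝 x] g := by
        filter_upwards [isOpen_ball.mem_nhds (closedBall_sub_ball2 hx)] with y hy
        exact (hg' hy).symm
      simp only [hF, wt_eq hx, this.lineDeriv_eq]
      ring
    · intro x hx
      simp only [mem_closedBall, dist_zero_right, not_le] at hx
      simp [hF, wt_zero hx]
  have hcl : ∀ᵐ x : EE n, x ∈ closedBall (0 : EE n) 1 → x ∈ ball (0 : EE n) 1 := by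
    have : volume (sphere (0 : EE n) 1) = 0 := Measure.addHaar_sphere_of_ne_zero _ _ (by norm_num)
    have h2 : ∀ᵐ x : EE n, x ∉ sphere (0 : EE n) 1 := measure_eq_zero_iff_ae_notMem.1 this
    filter_upwards [h2] with x hx hx'
    simp only [mem_sphere, dist_zero_right, mem_closedBall, mem_ball] at *
    exact lt_of_le_of_ne hx' hx
  have hdiff : ∀ᵐ x : EE n, x ∈ closedBall (0 : EE n) 1 → DifferentiableAt ℝ h x := by
    filter_upwards [hh.ae_differentiableWithinAt_of_mem (μ := volume)] with x hx hx'
    have := closedBall_sub_ball2 hx'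
    exact (hx this).differentiableAt (isOpen_ball.mem_nhds this)
  have hderiv : ∀ᵐ x : EE n, x ∈ closedBall (0 : EE n) 1 → lineDeriv ℝ F x e * g' x =
      (1 - ‖x‖^2)^(k+1) * (g x * lineDeriv ℝ h x e) - 2 * (k+1) * ((1 - ‖x‖^2)^k * (x i * h x * g x)) := by
    filter_upwards [hcl, hdiff] with x h1 h2 hx
    have hxb := h1 hx
    have hE : F =ᶠ[𝓝 x] fun y => (1 - ‖y‖^2)^(k+1) * h y := by
      filter_upwards [isOpen_ball.mem_nhds hxb] with y hy
      simp only [hF, wt_eq (ball_subset_closedBall hy)]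
    rw [hE.lineDeriv_eq]
    have hl : HasDerivAt (fun t : ℝ => x + t • e) e 0 := by
      simpa using ((hasDerivAt_id (0:ℝ)).smul_const e).const_add x
    have hn : HasDerivAt (fun t : ℝ => (1 - ‖x + t • e‖^2)^(k+1))
        (((k+1 : ℕ) : ℝ) * (1 - ‖x‖^2)^k * (-(2 * x i))) 0 := by
      have := (hl.norm_sq.const_sub 1).fun_pow (k+1)
      refine this.congr_deriv ?_
      simp [he, EuclideanSpace.inner_single_right]
    have hh' : HasDerivAt (fun t : ℝ => h (x + t • e)) (lineDeriv ℝ h x e) 0 :=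
      ((h2 hx).lineDifferentiableAt.hasLineDerivAt : HasLineDerivAt ℝ h _ x e)
    have : HasLineDerivAt ℝ (fun y => (1 - ‖y‖^2)^(k+1) * h y) _ x e := hn.mul hh'
    rw [this.lineDeriv, ← hg' (closedBall_sub_ball2 hx)]
    simp only [zero_smul, add_zero]
    push_cast
    ring
  have hiFF : IntegrableOn (fun x => lineDeriv ℝ F x e * g' x) (closedBall (0 : EE n) 1) := by
    apply IntegrableOn.mul_continuousOn _ hg'L.continuous.continuousOn (isCompact_closedBall _ _)
    exact (hFL.locallyIntegrable_lineDeriv e).integrableOn_isCompact (isCompact_closedBall _ _)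
  have hcont : JI k (fun x => x i * h x * g x) := by
    apply JI.of_cont
    have := hh.continuousOn.mono (closedBall_sub_ball2 (n := n))
    have := hg.continuousOn.mono (closedBall_sub_ball2 (n := n))
    fun_prop
  have hJI : JI (k+1) (fun x => g x * lineDeriv ℝ h x e) := by
    have := Integrable.add hiFF (Integrable.const_mul hcont (2 * (k+1)))
    refine this.congr ?_
    rw [EventuallyEq, ae_restrict_iff' measurableSet_closedBall]
    filter_upwards [hderiv] with x hx hxB
    simp only [Pi.add_apply]
    rw [hx hxB]; ring
  refine ⟨hJI, ?_⟩
  rw [← lhs, main]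
  rw [← setIntegral_eq_integral_of_forall_compl_eq_zero (s := closedBall (0 : EE n) 1)]
  · have : ∫ x in closedBall (0 : EE n) 1, lineDeriv ℝ F x (-e) * g' x =
      ∫ x in closedBall (0 : EE n) 1, (2 * (k+1) * ((1 - ‖x‖^2)^k * (x i * h x * g x)) - (1 - ‖x‖^2)^(k+1) * (g x * lineDeriv ℝ h x e)) := by
      apply setIntegral_congr_ae measurableSet_closedBall
      filter_upwards [hderiv] with x hx hxB
      rw [lineDeriv_neg, neg_mul, hx hxB]; ring
    rw [this, integral_sub (Integrable.const_mul hcont _) hJI, integral_const_mul]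
    unfold J
    ring
  · intro x hx
    have hx' : (closedBall (0 : EE n) 1)ᶜ ∈ 𝓝 x := isClosed_closedBall.isOpen_compl.mem_nhds hx
    have : F =ᶠ[𝓝 x] fun _ => (0:ℝ) := by
      filter_upwards [hx'] with y hy
      simp only [mem_compl_iff, mem_closedBall, dist_zero_right, not_le] at hy
      simp [hF, wt_zero hy]
    rw [this.lineDeriv_eq]
    simp [lineDeriv]

lemma J_sum {ι : Type*} (s : Finset ι) {k : ℕ} {f : ι → EE n → ℝ} (hf : ∀ i ∈ s, JI k (f i)) :
    J k (fun x => ∑ i ∈ s, f i x) = ∑ i ∈ s, J k (f i) := by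
  unfold J
  rw [← integral_finsetSum s hf]
  congr 1; ext x; rw [Finset.mul_sum]

lemma JI_sum {ι : Type*} (s : Finset ι) {k : ℕ} {f : ι → EE n → ℝ} (hf : ∀ i ∈ s, JI k (f i)) :
    JI k (fun x => ∑ i ∈ s, f i x) := by
  have := integrable_finsetSum s hf
  refine this.congr (ae_of_all _ fun x => ?_)
  simp [Finset.mul_sum]

theorem ibp {k : ℕ} {v g : EE n → ℝ} {L L' : ℝ≥0} (hv : Reg L 0 2 v) (hg : Reg L' 0 2 g) :
    JI (k+1) (fun x => g x * lapGrad v x) ∧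
    J (k+1) (fun x => inner ℝ (gradient v x) (gradient g x)) =
      - J (k+1) (fun x => g x * lapGrad v x) +
        2 * (k+1) * J k (fun x => inner ℝ x (gradient v x) * g x) := by
  obtain ⟨K, hK⟩ := hg.lipschitz
  have hvi : ∀ i : Fin n, LipschitzOnWith L (fun x => gradient v x i) (ball 0 2) := by
    intro i
    refine LipschitzOnWith.of_dist_le_mul fun x hx y hy => ?_
    refine le_trans ?_ (hv.lip.dist_le_mul x hx y hy)
    rw [Real.dist_eq, dist_eq_norm]
    have := PiLp.norm_apply_le (gradient v x - gradient v y) i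
    simpa using this
  have hI := fun i => (ibp1 (k := k) (hvi i) hK i).1
  have hE := fun i => (ibp1 (k := k) (hvi i) hK i).2
  have hdiff : ∀ᵐ x : EE n, x ∈ closedBall (0 : EE n) 1 → DifferentiableAt ℝ (gradient v) x := by
    filter_upwards [hv.lip.ae_differentiableWithinAt_of_mem (μ := volume)] with x hx hx'
    have := closedBall_sub_ball2 hx'
    exact (hx this).differentiableAt (isOpen_ball.mem_nhds this)
  have hlap : ∀ᵐ x : EE n, x ∈ closedBall (0 : EE n) 1 →
      ∑ i, g x * lineDeriv ℝ (fun x => gradient v x i) x (EuclideanSpace.single i 1) = g x * lapGrad v x := by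
    filter_upwards [hdiff] with x hx hxB
    unfold lapGrad
    rw [Finset.mul_sum]
    refine Finset.sum_congr rfl fun i _ => ?_
    congr 1
    have h1 : HasFDerivAt (fun x => gradient v x i) ((EuclideanSpace.proj i : EE n →L[ℝ] ℝ).comp (fderiv ℝ (gradient v) x)) x :=
      (EuclideanSpace.proj i : EE n →L[ℝ] ℝ).hasFDerivAt.comp x (hx hxB).hasFDerivAt
    rw [(h1.hasLineDerivAt _).lineDeriv]
    simp
  have hgc := hg.cont.mono (closedBall_sub_ball2 (n := n))
  have hggc := hg.gcont.mono (closedBall_sub_ball2 (n := n))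
  have hvgc := hv.gcont.mono (closedBall_sub_ball2 (n := n))
  have hl : ∀ i, ∀ x ∈ closedBall (0 : EE n) 1, lineDeriv ℝ g x (EuclideanSpace.single i 1) = gradient g x i := by
    intro i x hx
    rw [((hg.diff x (closedBall_sub_ball2 hx)).hasFDerivAt.hasLineDerivAt _).lineDeriv]
    rw [← inner_gradient_left, EuclideanSpace.inner_single_right]
    simp
  have e1 : J (k+1) (fun x => inner ℝ (gradient v x) (gradient g x)) =
      ∑ i, J (k+1) (fun x => gradient v x i * lineDeriv ℝ g x (EuclideanSpace.single i 1)) := by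
    rw [← J_sum]
    · apply J_congr
      intro x hx
      rw [PiLp.inner_apply]
      refine Finset.sum_congr rfl fun i _ => ?_
      rw [hl i x hx]; simp [mul_comm]
    · intro i _
      refine JI.congr_ae (f := fun x => gradient v x i * gradient g x i) (JI.of_cont (by fun_prop)) (ae_of_all _ fun x hx => ?_)
      rw [hl i x hx]
  refine ⟨(JI_sum Finset.univ fun i _ => hI i).congr_ae hlap, ?_⟩
  rw [e1, ← J_congr_ae hlap, J_sum _ (fun i _ => hI i), Finset.sum_congr rfl (fun i _ => hE i),
    Finset.sum_add_distrib, Finset.sum_neg_distrib, ← Finset.mul_sum,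
    ← J_sum (k := k) (f := fun i x => x i * gradient v x i * g x)]
  · congr 2
    apply J_congr
    intro x _
    simp only
    rw [← Finset.sum_mul, PiLp.inner_apply]
    congr 1
    refine Finset.sum_congr rfl fun i _ => ?_
    simp [mul_comm]
  · intro i _
    exact JI.of_cont (by fun_prop)


/-- The weighted Weiss energy. -/
def Wen (v : EE n → ℝ) : ℝ :=
  J 2 (fun x => 1 / 2 * ‖gradient v x‖ ^ 2 + v x) - 4 * J 1 (fun x => v x ^ 2)

/-- The defect of 2-homogeneity. -/
def Zf (v : EE n → ℝ) (x : EE n) : ℝ := inner ℝ x (gradient v x) - 2 * v x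

lemma Reg.grad_sub {L L' : ℝ≥0} {c : EE n} {R : ℝ} {v w : EE n → ℝ} (hv : Reg L c R v)
    (hw : Reg L' c R w) {x : EE n} (hx : x ∈ ball c R) :
    gradient (fun x => v x - w x) x = gradient v x - gradient w x := by
  have h1 := (hv.diff x hx).hasGradientAt.hasFDerivAt
  have h2 := (hw.diff x hx).hasGradientAt.hasFDerivAt
  have := h1.fun_sub h2
  rw [← map_sub] at this
  exact (hasGradientAt_iff_hasFDerivAt.2 this).gradient

lemma Reg.sub {L L' : ℝ≥0} {c : EE n} {R : ℝ} {v w : EE n → ℝ} (hv : Reg L c R v)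
    (hw : Reg L' c R w) : Reg (L + L') c R (fun x => v x - w x) := by
  refine ⟨fun x hx => (hv.diff x hx).fun_sub (hw.diff x hx), ?_⟩
  refine LipschitzOnWith.of_dist_le_mul fun x hx y hy => ?_
  rw [hv.grad_sub hw hx, hv.grad_sub hw hy]
  have h1 := hv.lip.dist_le_mul x hx y hy
  have h2 := hw.lip.dist_le_mul x hx y hy
  have := dist_sub_sub_le (gradient v x) (gradient w x) (gradient v y) (gradient w y)
  push_cast
  linarith

lemma Reg.one {c : EE n} {R : ℝ} : Reg 0 c R (fun _ : EE n => (1:ℝ)) := by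
  refine ⟨fun x _ => differentiableAt_const _, ?_⟩
  have : gradient (fun _ : EE n => (1:ℝ)) = fun _ => 0 := by ext1 x; simp
  rw [this]
  exact LipschitzOnWith.of_dist_le_mul fun x hx y hy => by simp

section quad
variable {A : Matrix (Fin n) (Fin n) ℝ}

/-- The linear map of a matrix. -/
def TA (A : Matrix (Fin n) (Fin n) ℝ) : EE n →L[ℝ] EE n := Matrix.toEuclideanCLM (𝕜 := ℝ) A

lemma TA_apply (x : EE n) (i : Fin n) : TA A x i = ∑ j, A i j * x j := by
  unfold TA
  rw [Matrix.ofLp_toEuclideanCLM]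
  rfl

lemma quad_eq (x : EE n) : quadForm A x = 1 / 2 * inner ℝ (TA A x) x := by
  unfold quadForm
  rw [PiLp.inner_apply]
  congr 1
  refine Finset.sum_congr rfl fun i _ => ?_
  rw [TA_apply]
  simp only [RCLike.inner_apply, conj_trivial]
  rw [Finset.mul_sum]
  refine Finset.sum_congr rfl fun j _ => by ring

lemma TA_symm (hA : A.IsHermitian) (x y : EE n) : inner ℝ (TA A x) y = inner ℝ (TA A y) x := by
  simp only [PiLp.inner_apply, TA_apply, RCLike.inner_apply, conj_trivial, Finset.mul_sum]
  rw [Finset.sum_comm]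
  refine Finset.sum_congr rfl fun i _ => Finset.sum_congr rfl fun j _ => ?_
  have : A j i = A i j := by simpa using hA.apply i j
  rw [this]; ring

lemma quad_grad (hA : A.IsHermitian) (x : EE n) : HasGradientAt (quadForm A) (TA A x) x := by
  have h1 : HasFDerivAt (fun x => inner ℝ (TA A x) x) _ x := (TA A).hasFDerivAt.inner ℝ (hasFDerivAt_id x)
  have h2 := h1.const_mul (1/2)
  rw [hasGradientAt_iff_hasFDerivAt]
  have : quadForm A = fun x => 1 / 2 * inner ℝ (TA A x) x := by ext x; exact quad_eq x
  rw [this]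
  refine h2.congr_fderiv ?_
  ext y
  simp only [fderivInnerCLM_apply, ContinuousLinearMap.comp_apply, ContinuousLinearMap.prod_apply, smul_apply, InnerProductSpace.toDual_apply_apply, ContinuousLinearMap.id_apply, smul_eq_mul, id]
  rw [TA_symm hA y x]
  ring

lemma quad_gradient (hA : A.IsHermitian) : gradient (quadForm A) = TA A := by
  ext1 x; exact (quad_grad hA x).gradient

lemma quad_reg (hA : A.IsHermitian) (c : EE n) (R : ℝ) : Reg ‖TA A‖₊ c R (quadForm A) :=
  ⟨fun x _ => (quad_grad hA x).differentiableAt, by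
    rw [quad_gradient hA]; exact (TA A).lipschitz.lipschitzOnWith⟩

lemma quad_lap (hA : A.IsHermitian) (x : EE n) : lapGrad (quadForm A) x = A.trace := by
  unfold lapGrad
  rw [quad_gradient hA]
  simp [TA_apply, Matrix.trace, Pi.single_apply]

lemma quad_euler (hA : A.IsHermitian) (x : EE n) :
    inner ℝ x (gradient (quadForm A) x) = 2 * quadForm A x := by
  rw [quad_gradient hA, quad_eq, real_inner_comm]; ring

lemma quad_Z (hA : A.IsHermitian) (x : EE n) : Zf (quadForm A) x = 0 := by
  unfold Zf; rw [quad_euler hA]; ring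

lemma quad_cont (A : Matrix (Fin n) (Fin n) ℝ) : Continuous (quadForm A) := by
  have : quadForm A = fun x => 1 / 2 * inner ℝ (TA A x) x := by ext x; exact quad_eq x
  rw [this]; fun_prop

lemma quad_smul (t : ℝ) (x : EE n) : quadForm A (t • x) = t ^ 2 * quadForm A x := by
  simp only [quad_eq, map_smul, inner_smul_left, inner_smul_right, conj_trivial]; ring

lemma quad_nonneg (hA : A.PosSemidef) (x : EE n) : 0 ≤ quadForm A x := by
  have h := hA.dotProduct_mulVec_nonneg (x : Fin n → ℝ)
  unfold quadForm
  simp only [dotProduct, Matrix.mulVec, star_trivial, Finset.mul_sum] at h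
  have : ∑ i, ∑ j, A i j * x i * x j = ∑ i, ∑ j, x i * (A i j * x j) :=
    Finset.sum_congr rfl fun i _ => Finset.sum_congr rfl fun j _ => by ring
  rw [this]; positivity

end quad

lemma ibp2 {v g : EE n → ℝ} {L L' : ℝ≥0} (hv : Reg L 0 2 v) (hg : Reg L' 0 2 g) :
    JI 2 (fun x => g x * lapGrad v x) ∧ J 2 (fun x => inner ℝ (gradient v x) (gradient g x)) =
      - J 2 (fun x => g x * lapGrad v x) + 4 * J 1 (fun x => inner ℝ x (gradient v x) * g x) := by
  obtain ⟨h1, h2⟩ := ibp (k := 1) hv hg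
  refine ⟨h1, ?_⟩
  rw [h2]; push_cast; ring

lemma ibp3 {v g : EE n → ℝ} {L L' : ℝ≥0} (hv : Reg L 0 2 v) (hg : Reg L' 0 2 g) :
    JI 3 (fun x => g x * lapGrad v x) ∧ J 3 (fun x => inner ℝ (gradient v x) (gradient g x)) =
      - J 3 (fun x => g x * lapGrad v x) + 6 * J 2 (fun x => inner ℝ x (gradient v x) * g x) := by
  obtain ⟨h1, h2⟩ := ibp (k := 2) hv hg
  refine ⟨h1, ?_⟩
  rw [h2]; push_cast; ring

lemma weiss_eq {v1 v2 : EE n → ℝ} {L1 L2 : ℝ≥0} (h1 : Reg L1 0 2 v1) (h2 : Reg L2 0 2 v2) :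
    Wen v2 - Wen v1 = J 2 (fun x => 1 / 2 * ‖gradient v2 x - gradient v1 x‖ ^ 2) +
      J 2 (fun x => (v2 x - v1 x) * (1 - lapGrad v1 x)) +
      4 * J 1 (fun x => (v2 x - v1 x) * (Zf v1 x - (v2 x - v1 x))) := by
  obtain ⟨hI, hE⟩ := ibp2 h1 (h2.sub h1)
  have c1 := h1.cont.mono (closedBall_sub_ball2 (n := n))
  have c2 := h2.cont.mono (closedBall_sub_ball2 (n := n))
  have d1 := h1.gcont.mono (closedBall_sub_ball2 (n := n))
  have d2 := h2.gcont.mono (closedBall_sub_ball2 (n := n))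
  have e0 : J 2 (fun x => inner ℝ (gradient v1 x) (gradient (fun x => v2 x - v1 x) x)) =
      J 2 (fun x => inner ℝ (gradient v1 x) (gradient v2 x - gradient v1 x)) :=
    J_congr fun x hx => by rw [h2.grad_sub h1 (closedBall_sub_ball2 hx)]
  have e1 : J 2 (fun x => 1 / 2 * ‖gradient v2 x‖ ^ 2 + v2 x) =
      J 2 (fun x => 1 / 2 * ‖gradient v1 x‖ ^ 2 + v1 x) +
      J 2 (fun x => inner ℝ (gradient v1 x) (gradient v2 x - gradient v1 x)) +
      J 2 (fun x => 1 / 2 * ‖gradient v2 x - gradient v1 x‖ ^ 2) + J 2 (fun x => v2 x - v1 x) := by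
    rw [← J_add, ← J_add, ← J_add]
    · apply J_congr
      intro x _
      have : gradient v2 x = gradient v1 x + (gradient v2 x - gradient v1 x) := by abel
      conv_lhs => rw [this, norm_add_sq_real]
      ring
    all_goals exact JI.of_cont (by fun_prop)
  have e2 : J 2 (fun x => (v2 x - v1 x) * (1 - lapGrad v1 x)) =
      J 2 (fun x => v2 x - v1 x) - J 2 (fun x => (v2 x - v1 x) * lapGrad v1 x) := by
    rw [← J_sub (JI.of_cont (by fun_prop)) hI]
    apply J_congr; intro x _; ring
  have e3 : J 1 (fun x => v2 x ^ 2) = J 1 (fun x => v1 x ^ 2) + 2 * J 1 (fun x => v1 x * (v2 x - v1 x))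
      + J 1 (fun x => (v2 x - v1 x) ^ 2) := by
    rw [← J_smul, ← J_add, ← J_add]
    · apply J_congr; intro x _; ring
    all_goals exact JI.of_cont (by fun_prop)
  have e4 : J 1 (fun x => (v2 x - v1 x) * (Zf v1 x - (v2 x - v1 x))) =
      J 1 (fun x => inner ℝ x (gradient v1 x) * (v2 x - v1 x)) - 2 * J 1 (fun x => v1 x * (v2 x - v1 x))
      - J 1 (fun x => (v2 x - v1 x) ^ 2) := by
    rw [← J_smul, ← J_sub, ← J_sub]
    · apply J_congr; intro x _; unfold Zf; ring
    all_goals exact JI.of_cont (by fun_prop)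
  unfold Wen
  rw [e0] at hE
  rw [e1, e2, e3, e4]
  linarith

lemma weiss_lower {v1 v2 : EE n → ℝ} {L1 L2 : ℝ≥0} (h1 : Reg L1 0 2 v1) (h2 : Reg L2 0 2 v2)
    (h : ∀ᵐ x, x ∈ closedBall (0 : EE n) 1 → 0 ≤ (v2 x - v1 x) * (1 - lapGrad v1 x)) :
    4 * J 1 (fun x => (v2 x - v1 x) * (Zf v1 x - (v2 x - v1 x))) ≤ Wen v2 - Wen v1 := by
  rw [weiss_eq h1 h2]
  have := J_nonneg_ae (k := 2) h
  have := J_nonneg (n := n) (k := 2) (f := fun x => 1 / 2 * ‖gradient v2 x - gradient v1 x‖ ^ 2) (fun x _ => by positivity)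
  linarith

lemma monneau {v : EE n → ℝ} {L : ℝ≥0} {A : Matrix (Fin n) (Fin n) ℝ} (hA : MemP A) (h : Reg L 0 2 v)
    (hv : ∀ᵐ x, x ∈ closedBall (0 : EE n) 1 → (v x - quadForm A x) * (1 - lapGrad v x) ≤ 0) :
    2 * (Wen v - Wen (quadForm A)) ≤ 4 * J 1 (fun x => (v x - quadForm A x) * Zf v x) := by
  have hH := hA.1.1
  have hq := quad_reg hH 0 2
  obtain ⟨hI, hE⟩ := ibp2 h (h.sub hq)
  obtain ⟨hI', hE'⟩ := ibp2 hq (h.sub hq)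
  have e := weiss_eq hq h
  have c1 := h.cont.mono (closedBall_sub_ball2 (n := n))
  have d1 := h.gcont.mono (closedBall_sub_ball2 (n := n))
  have c2 := quad_cont A
  have d2 : Continuous (gradient (quadForm A)) := by rw [quad_gradient hH]; fun_prop
  have z1 : J 2 (fun x => (v x - quadForm A x) * (1 - lapGrad (quadForm A) x)) = 0 := by
    simp [quad_lap hH, hA.2, J]
  have e1 : J 2 (fun x => 1 / 2 * ‖gradient v x - gradient (quadForm A) x‖ ^ 2) =
      1 / 2 * (J 2 (fun x => inner ℝ (gradient v x) (gradient (fun x => v x - quadForm A x) x)) -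
        J 2 (fun x => inner ℝ (gradient (quadForm A) x) (gradient (fun x => v x - quadForm A x) x))) := by
    have r1 : ∀ w : EE n → ℝ, J 2 (fun x => inner ℝ (gradient w x) (gradient (fun x => v x - quadForm A x) x)) =
      J 2 (fun x => inner ℝ (gradient w x) (gradient v x - gradient (quadForm A) x)) := fun w =>
      J_congr fun x hx => by rw [h.grad_sub hq (closedBall_sub_ball2 hx)]
    rw [r1, r1, ← J_sub, ← J_smul]
    · apply J_congr; intro x _
      rw [← inner_sub_left, real_inner_self_eq_norm_sq]
    all_goals exact JI.of_cont (by fun_prop)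
  have e2 : J 2 (fun x => (v x - quadForm A x) * (1 - lapGrad v x)) =
      J 2 (fun x => (v x - quadForm A x) * lapGrad (quadForm A) x) - J 2 (fun x => (v x - quadForm A x) * lapGrad v x) := by
    rw [← J_sub hI' hI]
    apply J_congr; intro x _; rw [quad_lap hH, hA.2]; ring
  have e3 : J 2 (fun x => (v x - quadForm A x) * (1 - lapGrad v x)) ≤ 0 := by
    have := J_nonneg_ae (k := 2) (f := fun x => (-1) * ((v x - quadForm A x) * (1 - lapGrad v x)))
      (by filter_upwards [hv] with x hx hxB; linarith [hx hxB])
    rw [J_smul] at this; linarith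
  have e4 : J 1 (fun x => (v x - quadForm A x) * (Zf (quadForm A) x - (v x - quadForm A x))) =
      - J 1 (fun x => (v x - quadForm A x) ^ 2) := by
    rw [← neg_one_mul, ← J_smul]
    apply J_congr; intro x _; rw [quad_Z hH]; ring
  have e5 : J 1 (fun x => inner ℝ x (gradient v x) * (v x - quadForm A x)) -
      J 1 (fun x => inner ℝ x (gradient (quadForm A) x) * (v x - quadForm A x)) =
      J 1 (fun x => (v x - quadForm A x) * Zf v x) + 2 * J 1 (fun x => (v x - quadForm A x) ^ 2) := by
    rw [← J_sub, ← J_smul, ← J_add]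
    · apply J_congr; intro x _; rw [quad_euler hH]; unfold Zf; ring
    all_goals exact JI.of_cont (by (try unfold Zf); fun_prop)
  linarith

lemma contact_eq {v : EE n → ℝ} {L : ℝ≥0} (h : Reg L 0 2 v)
    (hv : ∀ᵐ x, x ∈ closedBall (0 : EE n) 1 → v x * lapGrad v x = v x) :
    JI 2 (fun x => lapGrad v x) ∧ J 2 (fun x => lapGrad v x) = 4 * (n + 6) * Wen v + 4 * J 1 (Zf v) + 2 * J 2 (Zf v)
      - 8 * (n + 6) * J 1 (fun x => v x * Zf v x) := by
  have h1H : (1 : Matrix (Fin n) (Fin n) ℝ).IsHermitian := Matrix.isHermitian_one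
  have hT : ∀ x : EE n, TA (1 : Matrix (Fin n) (Fin n) ℝ) x = x := by
    intro x; simp [TA]
  have c1 := h.cont.mono (closedBall_sub_ball2 (n := n))
  have d1 := h.gcont.mono (closedBall_sub_ball2 (n := n))
  obtain ⟨hI1, hE1⟩ := ibp2 h (Reg.one (c := 0) (R := 2))
  obtain ⟨hI2, hE2⟩ := ibp2 (quad_reg h1H 0 2) h
  obtain ⟨hI3, hE3⟩ := ibp2 h h
  simp only [one_mul, mul_one] at hE1 hI1
  refine ⟨hI1, ?_⟩
  simp only [quad_gradient h1H, quad_lap h1H, hT, Matrix.trace_one, Fintype.card_fin] at hE2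
  have g0 : J 2 (fun x => inner ℝ (gradient v x) (gradient (fun _ : EE n => (1:ℝ)) x)) = 0 := by
    simp [J]
  have f1 : J 2 (fun x => v x * (n:ℝ)) = n * J 2 v := by
    rw [← J_smul]; apply J_congr; intro x _; ring
  have f2 : J 1 (fun x => inner ℝ x x * v x) = J 1 v - J 2 v := by
    have : J 2 v = J 1 (fun x => (1 - ‖x‖^2) * v x) := by
      unfold J; congr 1; ext x; ring
    rw [this, ← J_sub]
    · apply J_congr; intro x _; rw [real_inner_self_eq_norm_sq]; ring
    all_goals exact JI.of_cont (by fun_prop)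
  have f3 : J 2 (fun x => v x * lapGrad v x) = J 2 v := J_congr_ae hv
  have f4 : Wen v = 1 / 2 * J 2 (fun x => inner ℝ (gradient v x) (gradient v x)) + J 2 v - 4 * J 1 (fun x => v x ^ 2) := by
    unfold Wen
    rw [← J_smul (1 / 2), ← J_add]
    · congr 1; apply J_congr; intro x _; rw [real_inner_self_eq_norm_sq]
    all_goals exact JI.of_cont (by fun_prop)
  have f5 : ∀ k, J k (Zf v) = J k (fun x => inner ℝ x (gradient v x)) - 2 * J k v := by
    intro k
    rw [← J_smul, ← J_sub]
    · rfl
    all_goals exact JI.of_cont (by fun_prop)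
  have f6 : J 1 (fun x => v x * Zf v x) = J 1 (fun x => inner ℝ x (gradient v x) * v x) - 2 * J 1 (fun x => v x ^ 2) := by
    rw [← J_smul, ← J_sub]
    · apply J_congr; intro x _; unfold Zf; ring
    all_goals exact JI.of_cont (by fun_prop)
  rw [g0] at hE1
  rw [f1, f2] at hE2
  rw [f3] at hE3
  rw [f4, f5, f5, f6]
  rw [hE3, hE2]
  linarith


/-- A local solution of the obstacle problem on a ball. -/
structure Sol {n : ℕ} (L : ℝ≥0) (c : EE n) (R : ℝ) (u : EE n → ℝ) : Prop where
  reg : Reg L c R u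
  nonneg : ∀ x ∈ ball c R, 0 ≤ u x
  lap : ∀ᵐ x, x ∈ ball c R → lapGrad u x = if 0 < u x then 1 else 0

/-- The quadratic rescaling. -/
def resc {n : ℕ} (u : EE n → ℝ) (z : EE n) (t : ℝ) : EE n → ℝ := fun x => u (z + t • x) / t ^ 2

lemma ae_aff {P : EE n → Prop} (h : ∀ᵐ x, P x) (z : EE n) {t : ℝ} (ht : t ≠ 0) :
    ∀ᵐ y : EE n, P (z + t • y) := by
  rw [ae_iff] at h ⊢
  have h1 : volume ((fun y => z + y) ⁻¹' {a : EE n | ¬ P a}) = 0 := by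
    rw [measure_preimage_add, h]
  have h2 : volume ((t • ·) ⁻¹' ((fun y => z + y) ⁻¹' {a : EE n | ¬ P a})) = 0 := by
    rw [Measure.addHaar_preimage_smul _ ht, h1, mul_zero]
  exact h2

lemma resc_hasGrad {u : EE n → ℝ} {z y : EE n} {t : ℝ} (ht : t ≠ 0)
    (h : DifferentiableAt ℝ u (z + t • y)) :
    HasGradientAt (resc u z t) (t⁻¹ • gradient u (z + t • y)) y := by
  have h1 := h.hasGradientAt.hasFDerivAt
  have h2 : HasFDerivAt (fun y : EE n => z + t • y) (t • ContinuousLinearMap.id ℝ (EE n)) y :=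
    ((hasFDerivAt_id y).const_smul t).const_add z
  have h3 := (h1.comp y h2).mul_const ((t^2)⁻¹)
  rw [hasGradientAt_iff_hasFDerivAt]
  refine HasFDerivAt.congr_fderiv (f := fun y => u (z + t • y) * (t^2)⁻¹) h3 ?_
  ext w
  simp [inner_smul_left, inner_smul_right]
  field_simp

lemma Sol.mono {L L' : ℝ≥0} {c c' : EE n} {R R' : ℝ} {u : EE n → ℝ} (h : Sol L c R u) (hL : L ≤ L')
    (hb : ball c' R' ⊆ ball c R) : Sol L' c' R' u :=
  ⟨⟨fun x hx => h.reg.diff x (hb hx), (h.reg.lip.mono hb).weaken hL⟩, fun x hx => h.nonneg x (hb hx),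
    by filter_upwards [h.lap] with x hx hxb using hx (hb hxb)⟩

lemma Sol.resc {L : ℝ≥0} {c z : EE n} {R R' t : ℝ} {u : EE n → ℝ} (h : Sol L c R u) (ht : 0 < t)
    (hb : ∀ y ∈ ball (0 : EE n) R', z + t • y ∈ ball c R) : Sol L 0 R' (resc u z t) := by
  have hg : ∀ y ∈ ball (0 : EE n) R', gradient (_root_.resc u z t) y = t⁻¹ • gradient u (z + t • y) := fun y hy =>
    (resc_hasGrad ht.ne' (h.reg.diff _ (hb y hy))).gradient
  refine ⟨⟨fun y hy => (resc_hasGrad ht.ne' (h.reg.diff _ (hb y hy))).differentiableAt, ?_⟩, ?_, ?_⟩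
  · refine LipschitzOnWith.of_dist_le_mul fun x hx y hy => ?_
    rw [hg x hx, hg y hy, dist_eq_norm, ← smul_sub, norm_smul, ← dist_eq_norm]
    have := h.reg.lip.dist_le_mul _ (hb x hx) _ (hb y hy)
    have e : dist (z + t • x) (z + t • y) = t * dist x y := by
      rw [dist_add_left, dist_smul₀, Real.norm_of_nonneg ht.le]
    rw [e] at this
    rw [Real.norm_of_nonneg (by positivity)]
    calc t⁻¹ * _ ≤ t⁻¹ * (L * (t * dist x y)) := by gcongr
      _ = L * dist x y := by field_simp
  · intro x hx
    exact div_nonneg (h.nonneg _ (hb x hx)) (by positivity)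
  · have hd : ∀ᵐ x, x ∈ ball c R → DifferentiableWithinAt ℝ (gradient u) (ball c R) x :=
      h.reg.lip.ae_differentiableWithinAt_of_mem
    filter_upwards [ae_aff h.lap z ht.ne', ae_aff hd z ht.ne'] with y h1 h2 hy
    have h1 := h1 (hb y hy)
    have h2 := (h2 (hb y hy)).differentiableAt (isOpen_ball.mem_nhds (hb y hy))
    have e : lapGrad (_root_.resc u z t) y = lapGrad u (z + t • y) := by
      unfold lapGrad
      have e1 : gradient (_root_.resc u z t) =ᶠ[𝓝 y] fun y => t⁻¹ • gradient u (z + t • y) := by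
        filter_upwards [isOpen_ball.mem_nhds hy] with w hw using hg w hw
      have e2 : HasFDerivAt (fun y : EE n => z + t • y) (t • ContinuousLinearMap.id ℝ (EE n)) y :=
        ((hasFDerivAt_id y).const_smul t).const_add z
      have e3 := ((h2.hasFDerivAt.comp y e2).const_smul t⁻¹)
      have e4 : fderiv ℝ (gradient (_root_.resc u z t)) y = fderiv ℝ (gradient u) (z + t • y) := by
        rw [e1.fderiv_eq]
        have e5 := e3.fderiv
        refine (show fderiv ℝ (fun y => t⁻¹ • gradient u (z + t • y)) y = _ from e5).trans ?_
        ext1 w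
        simp [smul_smul, ht.ne']
      rw [e4]
    rw [e, h1]
    have : 0 < _root_.resc u z t y ↔ 0 < u (z + t • y) := by
      unfold _root_.resc
      constructor
      · intro hh; by_contra hc
        exact absurd hh (not_lt.2 (div_nonpos_of_nonpos_of_nonneg (not_lt.1 hc) (by positivity)))
      · intro hh; positivity
    simp [this]

lemma resc_resc (u : EE n → ℝ) (z x : EE n) (r t : ℝ) :
    resc (resc u z r) x t = resc u (z + r • x) (r * t) := by
  ext y
  unfold resc
  rw [div_div, smul_add, smul_smul, ← add_assoc, ← mul_pow]

lemma Sol.resc0 {L : ℝ≥0} {z : EE n} {R R' t : ℝ} {u : EE n → ℝ} (h : Sol L z R u) (ht : 0 < t)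
    (hR : t * R' ≤ R) : Sol L 0 R' (_root_.resc u z t) := by
  apply h.resc ht
  intro y hy
  simp only [mem_ball, dist_self_add_left, dist_zero_right, norm_smul, Real.norm_of_nonneg ht.le] at hy ⊢
  calc t * ‖y‖ < t * R' := by gcongr
    _ ≤ R := hR

lemma Sol.grad_zero {L : ℝ≥0} {z : EE n} {R : ℝ} {u : EE n → ℝ} (h : Sol L z R u) (hR : 0 < R)
    (h0 : u z = 0) : gradient u z = 0 := by
  have : IsLocalMin u z := by
    filter_upwards [ball_mem_nhds z hR] with x hx
    rw [h0]; exact h.nonneg x hx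
  unfold gradient
  rw [this.fderiv_eq_zero, map_zero]

lemma Sol.grad_le {L : ℝ≥0} {R : ℝ} {u : EE n → ℝ} (h : Sol L 0 R u) (h0 : u 0 = 0) {x : EE n}
    (hx : x ∈ ball 0 R) : ‖gradient u x‖ ≤ L * ‖x‖ := by
  have hR : 0 < R := by
    by_contra hc; rw [ball_eq_empty.2 (not_lt.1 hc)] at hx; exact hx
  have := h.reg.lip.dist_le_mul x hx 0 (mem_ball_self hR)
  simpa [h.grad_zero hR h0] using this

lemma Sol.val_le {L : ℝ≥0} {R : ℝ} {u : EE n → ℝ} (h : Sol L 0 R u) (h0 : u 0 = 0) {x : EE n}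
    (hx : x ∈ ball 0 R) : |u x| ≤ L * ‖x‖ ^ 2 := by
  have hR : 0 < R := by
    by_contra hc; rw [ball_eq_empty.2 (not_lt.1 hc)] at hx; exact hx
  have := h.reg.taylor (mem_ball_self hR) hx
  simpa [h.grad_zero hR h0, h0] using this

lemma Sol.lip_val {L : ℝ≥0} {R : ℝ} {u : EE n → ℝ} (h : Sol L 0 R u) (h0 : u 0 = 0) {x y : EE n}
    (hx : x ∈ ball 0 R) (hy : y ∈ ball 0 R) : |u x - u y| ≤ L * R * ‖x - y‖ := by
  have := (convex_ball (0 : EE n) R).norm_image_sub_le_of_norm_fderiv_le (f := u) (C := L * R) (𝕜 := ℝ)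
    (fun x hx => h.reg.diff x hx) (fun x hx => ?_) hy hx
  · simpa using this
  · have h1 := h.grad_le h0 hx
    have h2 : ‖x‖ ≤ R := by simpa using (mem_ball.1 hx).le
    have : ‖fderiv ℝ u x‖ = ‖gradient u x‖ := by
      unfold gradient; simp
    rw [this]
    exact h1.trans (by gcongr)

lemma mono_of_quad {f : ℝ → ℝ} {r0 C : ℝ} (hC : 0 ≤ C)
    (h : ∀ r, 0 < r → ∀ t, 0 ≤ t → t ≤ 1 / 2 → (1 + t) * r ≤ r0 → f r - C * t ^ 2 ≤ f ((1 + t) * r))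
    {r s : ℝ} (hr : 0 < r) (hrs : r ≤ s) (hs : s ≤ r0) : f r ≤ f s := by
  set D := (s - r) / r with hD
  have hD0 : 0 ≤ D := div_nonneg (by linarith) hr.le
  have key : ∀ N : ℕ, 0 < N → 2 * D ≤ N → f r - C * D ^ 2 / N ≤ f s := by
    intro N hN hN2
    have hNp : (0:ℝ) < N := by exact_mod_cast hN
    have ind : ∀ i : ℕ, i ≤ N → f r - i * (C * (D / N) ^ 2) ≤ f (r + i * ((s - r) / N)) := by
      intro i
      induction i with
      | zero => intro _; simp
      | succ i ih =>
        intro hi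
        have ih := ih (by omega)
        have hq : 0 ≤ (s - r) / N := div_nonneg (by linarith) hNp.le
        have hti : r ≤ r + i * ((s - r) / N) := by
          have := mul_nonneg (Nat.cast_nonneg (α := ℝ) i) hq
          linarith
        set ti := r + i * ((s - r) / N) with hti'
        have htip : 0 < ti := by linarith
        have hle : ((s - r) / N) / ti ≤ D / N := by
          calc ((s - r) / N) / ti ≤ ((s - r) / N) / r := by gcongr
            _ = D / N := by rw [hD]; field_simp
        have e : (1 + ((s - r) / N) / ti) * ti = r + (i + 1 : ℕ) * ((s - r) / N) := by
          rw [add_mul, div_mul_cancel₀ _ htip.ne', hti']; push_cast; ring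
        have h1 := h ti htip (((s - r) / N) / ti) (by positivity) (hle.trans (by rw [div_le_iff₀ hNp]; linarith)) (by
          rw [e]
          have : ((i + 1 : ℕ) : ℝ) * ((s - r) / N) ≤ s - r := by
            rw [mul_div_assoc', div_le_iff₀ hNp, mul_comm]
            have : ((i+1 : ℕ) : ℝ) ≤ N := by exact_mod_cast hi
            exact mul_le_mul_of_nonneg_left this (by linarith)
          linarith)
        rw [e] at h1
        have h2 : C * (((s - r) / N) / ti) ^ 2 ≤ C * (D / N) ^ 2 := by gcongr
        push_cast at h1 ⊢
        linarith
    have := ind N le_rfl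
    have e : r + N * ((s - r) / N) = s := by field_simp; ring
    rw [e] at this
    have e2 : N * (C * (D / N) ^ 2) = C * D ^ 2 / N := by field_simp
    rwa [e2] at this
  have lim : Tendsto (fun N : ℕ => f r - C * D ^ 2 / N) atTop (𝓝 (f r - 0)) :=
    tendsto_const_nhds.sub (tendsto_const_div_atTop_nhds_zero_nat _)
  rw [sub_zero] at lim
  refine le_of_tendsto lim ?_
  filter_upwards [eventually_gt_atTop 0, eventually_ge_atTop ⌈2 * D⌉₊] with N h1 h2
  exact key N h1 (Nat.ceil_le.1 h2)


lemma norm_le_of_cb {x : EE n} (hx : x ∈ closedBall (0 : EE n) 1) : ‖x‖ ≤ 1 := by simpa using hx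

lemma Sol.Z_le {L : ℝ≥0} {v : EE n → ℝ} (h : Sol L 0 2 v) (h0 : v 0 = 0) {x : EE n}
    (hx : x ∈ closedBall (0 : EE n) 1) : |Zf v x| ≤ 3 * L := by
  have hx1 := norm_le_of_cb hx
  have hx2 := closedBall_sub_ball2 hx
  have h1 := h.val_le h0 hx2
  have h2 := h.grad_le h0 hx2
  have h3 := abs_real_inner_le_norm x (gradient v x)
  have hL : (0:ℝ) ≤ L := L.2
  have h4 : ‖x‖ * ‖gradient v x‖ ≤ L := by
    calc ‖x‖ * ‖gradient v x‖ ≤ 1 * (L * 1) := by gcongr; exact h2.trans (by gcongr)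
      _ = L := by ring
  have h5 : |v x| ≤ L := h1.trans (by
    calc (L:ℝ) * ‖x‖^2 ≤ (L:ℝ) * 1^2 := by gcongr
      _ = (L:ℝ) := by ring)
  unfold Zf
  rw [abs_le] at *
  constructor <;> linarith [h3.1, h3.2, h5.1, h5.2]

lemma Sol.Z_cont {L : ℝ≥0} {v : EE n → ℝ} (h : Sol L 0 2 v) : ContinuousOn (Zf v) (closedBall 0 1) := by
  have c1 := h.reg.cont.mono (closedBall_sub_ball2 (n := n))
  have d1 := h.reg.gcont.mono (closedBall_sub_ball2 (n := n))
  unfold Zf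
  fun_prop

lemma Sol.v_cont {L : ℝ≥0} {v : EE n → ℝ} (h : Sol L 0 2 v) : ContinuousOn v (closedBall 0 1) :=
  h.reg.cont.mono (closedBall_sub_ball2 (n := n))

lemma Sol.v_le {L : ℝ≥0} {v : EE n → ℝ} (h : Sol L 0 2 v) (h0 : v 0 = 0) {x : EE n}
    (hx : x ∈ closedBall (0 : EE n) 1) : |v x| ≤ L := by
  refine (h.val_le h0 (closedBall_sub_ball2 hx)).trans ?_
  have hx1 := norm_le_of_cb hx
  calc (L:ℝ) * ‖x‖^2 ≤ (L:ℝ) * 1^2 := by gcongr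
      _ = (L:ℝ) := by ring

lemma Sol.two {L : ℝ≥0} {v : EE n → ℝ} (h : Sol L 0 3 v) : Sol L 0 2 v :=
  h.mono le_rfl (ball_subset_ball (by norm_num))

lemma Sol.step {L : ℝ≥0} {v : EE n → ℝ} (h : Sol L 0 3 v) {t : ℝ} (ht : 0 ≤ t) (ht' : t ≤ 1 / 2) :
    Sol L 0 2 (_root_.resc v 0 (1 + t)) := h.resc0 (by linarith) (by linarith)

lemma step_err {L : ℝ≥0} {v : EE n → ℝ} (h : Sol L 0 3 v) (h0 : v 0 = 0) {t : ℝ} (ht : 0 ≤ t) (ht' : t ≤ 1 / 2)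
    {x : EE n} (hx : x ∈ closedBall (0 : EE n) 1) :
    |resc v 0 (1 + t) x - v x - t * Zf v x| ≤ 6 * L * t ^ 2 := by
  have hx1 := norm_le_of_cb hx
  have hx2 := closedBall_sub_ball2 hx
  have hx3 : x ∈ ball (0 : EE n) 3 := ball_subset_ball (by norm_num) hx2
  have hy3 : (1 + t) • x ∈ ball (0 : EE n) 3 := by
    simp only [mem_ball, dist_zero_right, norm_smul, Real.norm_of_nonneg (by linarith : (0:ℝ) ≤ 1 + t)]
    nlinarith [norm_nonneg x]
  have hT := h.reg.taylor hx3 hy3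
  have e1 : (1 + t) • x - x = t • x := by rw [add_smul, one_smul]; abel
  have hL : (0:ℝ) ≤ L := L.2
  have hv := h.two.v_le h0 hx
  have hg := h.two.grad_le h0 hx2
  have hi := abs_real_inner_le_norm x (gradient v x)
  have hi2 : |inner ℝ x (gradient v x)| ≤ L := hi.trans (by
    calc ‖x‖ * ‖gradient v x‖ ≤ 1 * (L * 1) := by gcongr; exact hg.trans (by gcongr)
      _ = L := by ring)
  rw [e1, inner_smul_right, norm_smul, Real.norm_of_nonneg ht, real_inner_comm] at hT
  have hT2 : (L:ℝ) * (t * ‖x‖)^2 ≤ L * t^2 := by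
    have : t * ‖x‖ ≤ t := by nlinarith [norm_nonneg x]
    gcongr
  unfold resc Zf
  rw [zero_add]
  set I := (inner ℝ x (gradient v x) : ℝ)
  set V := v x
  set W := v ((1 + t) • x)
  set E := W - V - t * I with hE
  have hEb : |E| ≤ L * t^2 := hT.trans hT2
  have hp : (0:ℝ) < (1 + t)^2 := by positivity
  have e : W / (1 + t)^2 - V - t * (I - 2 * V) = (E + V * (t^2 * (3 + 2 * t)) - t * I * (2 * t + t ^2)) / (1+t)^2 := by
    rw [hE]; field_simp; ring
  rw [e, abs_div, abs_of_pos hp, div_le_iff₀ hp]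
  have b1 : |V * (t^2 * (3 + 2 * t))| ≤ L * (t^2 * (3 + 2 * t)) := by
    rw [abs_mul, abs_of_nonneg (by positivity : 0 ≤ t^2 * (3 + 2 * t))]; gcongr
  have b2 : |t * I * (2 * t + t ^2)| ≤ t * L * (2 * t + t^2) := by
    rw [abs_mul, abs_mul, abs_of_nonneg ht, abs_of_nonneg (by positivity : 0 ≤ 2 * t + t ^2)]; gcongr
  have b3 := abs_sub (E + V * (t^2 * (3 + 2 * t))) (t * I * (2 * t + t ^2))
  have b4 := abs_add_le E (V * (t^2 * (3 + 2 * t)))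
  have : L * t^2 + L * (t^2 * (3 + 2 * t)) + t * L * (2 * t + t^2) ≤ 6 * L * t^2 * (1+t)^2 := by
    have : 6 * L * t^2 * (1+t)^2 - (L * t^2 + L * (t^2 * (3 + 2 * t)) + t * L * (2 * t + t^2)) = L * t^2 * (9 * t + 6 * t^2) := by ring
    have : 0 ≤ L * t^2 * (9 * t + 6 * t^2) := by positivity
    linarith
  linarith

lemma sol_sign {L : ℝ≥0} {v w : EE n → ℝ} (h : Sol L 0 2 v) (hw : ∀ x ∈ closedBall (0:EE n) 1, 0 ≤ w x) :
    ∀ᵐ x, x ∈ closedBall (0 : EE n) 1 → 0 ≤ (w x - v x) * (1 - lapGrad v x) := by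
  filter_upwards [h.lap] with x hx hxB
  rw [hx (closedBall_sub_ball2 hxB)]
  split_ifs with hc
  · simp
  · have : v x = 0 := le_antisymm (not_lt.1 hc) (h.nonneg x (closedBall_sub_ball2 hxB))
    rw [this]; have := hw x hxB; simpa using this

lemma weiss_growth {L : ℝ≥0} {v : EE n → ℝ} (h : Sol L 0 3 v) (h0 : v 0 = 0) {t : ℝ} (ht : 0 ≤ t) (ht' : t ≤ 1 / 2) :
    4 * t * J 1 (fun x => Zf v x ^ 2) - (400 * L ^ 2 * J 1 (fun _ : EE n => 1)) * t ^ 2 ≤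
      Wen (resc v 0 (1 + t)) - Wen v := by
  have hs := h.step ht ht'
  refine le_trans ?_ (weiss_lower h.two.reg hs.reg (sol_sign h.two fun x hx => hs.nonneg x (closedBall_sub_ball2 hx)))
  have c1 := h.two.v_cont
  have c2 := hs.v_cont
  have c3 := h.two.Z_cont
  have : t * J 1 (fun x => Zf v x ^ 2) - 100 * L^2 * t^2 * J 1 (fun _ : EE n => 1) ≤
      J 1 (fun x => (resc v 0 (1 + t) x - v x) * (Zf v x - (resc v 0 (1 + t) x - v x))) := by
    rw [← J_smul, ← J_smul, ← J_sub]
    · apply J_mono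
      · exact JI.of_cont (by fun_prop)
      · exact JI.of_cont (by fun_prop)
      · intro x hx
        have he := step_err h h0 ht ht' hx
        have hZ := h.two.Z_le h0 hx
        set d := resc v 0 (1 + t) x - v x
        set z := Zf v x
        set e := d - t * z with hedef
        have hd : d = t * z + e := by rw [hedef]; ring
        rw [hd]
        have hL : (0:ℝ) ≤ L := L.2
        have k1 : z^2 ≤ 9 * (L:ℝ)^2 := by
          have := sq_le_sq' (by linarith [(abs_le.1 hZ).1]) (abs_le.1 hZ).2
          linarith [this]
        have k2 : e^2 ≤ 36 * L^2 * t^2 := by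
          have h6 : |e| ≤ 6 * L * t := he.trans (by nlinarith [mul_nonneg hL ht])
          have := sq_le_sq' (by linarith [(abs_le.1 h6).1]) (abs_le.1 h6).2
          linarith [this]
        have k3 : |e * (1 - 2 * t) * z| ≤ 18 * L^2 * t^2 := by
          rw [abs_mul, abs_mul, abs_of_nonneg (by linarith : 0 ≤ 1 - 2 * t)]
          calc |e| * (1 - 2*t) * |z| ≤ (6 * L * t^2) * 1 * (3 * L) := by
                gcongr
                · linarith
                · linarith
            _ = 18 * L^2 * t^2 := by ring
        have k4 := (abs_le.1 k3).1
        nlinarith [sq_nonneg t, mul_le_mul_of_nonneg_left k1 (sq_nonneg t)]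
    all_goals exact JI.of_cont (by fun_prop)
  linarith

lemma J_one_nonneg (k : ℕ) : 0 ≤ J k (fun _ : EE n => (1:ℝ)) := (J_one_pos k).le

lemma sol_sign2 {L : ℝ≥0} {v : EE n → ℝ} {A : Matrix (Fin n) (Fin n) ℝ} (hA : MemP A) (h : Sol L 0 2 v) :
    ∀ᵐ x, x ∈ closedBall (0 : EE n) 1 → (v x - quadForm A x) * (1 - lapGrad v x) ≤ 0 := by
  filter_upwards [sol_sign (w := quadForm A) h fun x _ => quad_nonneg hA.1 x] with x hx hxB
  linarith [hx hxB]

lemma monneau_growth {L : ℝ≥0} {v : EE n → ℝ} {A : Matrix (Fin n) (Fin n) ℝ} (hA : MemP A) (h : Sol L 0 3 v)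
    (h0 : v 0 = 0) {M : ℝ} (hM : ∀ x ∈ closedBall (0 : EE n) 1, |quadForm A x| ≤ M)
    (hW : Wen (quadForm A) ≤ Wen v) {t : ℝ} (ht : 0 ≤ t) (ht' : t ≤ 1 / 2) :
    J 1 (fun x => (v x - quadForm A x) ^ 2) - (12 * L * (L + M) * J 1 (fun _ : EE n => 1)) * t ^ 2 ≤
      J 1 (fun x => (resc v 0 (1 + t) x - quadForm A x) ^ 2) := by
  have hs := h.step ht ht'
  have hm := monneau hA h.two.reg (sol_sign2 hA h.two)
  have c1 := h.two.v_cont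
  have c2 := hs.v_cont
  have c3 := h.two.Z_cont
  have c4 := quad_cont A
  have : J 1 (fun x => (v x - quadForm A x) ^ 2) + 2 * t * J 1 (fun x => (v x - quadForm A x) * Zf v x)
      - (12 * L * (L + M) * t^2) * J 1 (fun _ : EE n => 1) ≤ J 1 (fun x => (resc v 0 (1 + t) x - quadForm A x) ^ 2) := by
    rw [← J_smul, ← J_smul, ← J_add, ← J_sub]
    · apply J_mono
      · exact JI.of_cont (by fun_prop)
      · exact JI.of_cont (by fun_prop)
      · intro x hx
        have he := step_err h h0 ht ht' hx
        have hq := hM x hx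
        have hv := h.two.v_le h0 hx
        set d := resc v 0 (1 + t) x - v x with hd0
        set z := Zf v x
        set e := d - t * z with hedef
        have hd : resc v 0 (1 + t) x = v x + t * z + e := by rw [hedef, hd0]; ring
        rw [hd]
        have hL : (0:ℝ) ≤ L := L.2
        have k0 : |v x - quadForm A x| ≤ L + M := (abs_sub _ _).trans (by linarith)
        have k3 : |e * (v x - quadForm A x)| ≤ 6 * L * t^2 * (L + M) := by
          rw [abs_mul]; gcongr
        have k4 := (abs_le.1 k3).1
        nlinarith [sq_nonneg (t * z + e)]
    all_goals exact JI.of_cont (by fun_prop)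
  have : 0 ≤ 2 * t * J 1 (fun x => (v x - quadForm A x) * Zf v x) := by
    apply mul_nonneg (by linarith); linarith
  linarith

lemma quad_bound (A : Matrix (Fin n) (Fin n) ℝ) : ∃ M, 0 ≤ M ∧ ∀ x ∈ closedBall (0 : EE n) 1, |quadForm A x| ≤ M := by
  obtain ⟨M, hM⟩ := (isCompact_closedBall (0 : EE n) 1).exists_bound_of_continuousOn (quad_cont A).continuousOn
  exact ⟨M, (norm_nonneg _).trans (hM 0 (by simp)), hM⟩

/-- The common energy of the polynomials. -/
lemma Wen_quad {A : Matrix (Fin n) (Fin n) ℝ} (hA : MemP A) :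
    4 * (n + 6) * Wen (quadForm A) = J 2 (fun _ : EE n => (1:ℝ)) := by
  have h := (contact_eq (quad_reg hA.1.1 0 2) (by simp [quad_lap hA.1.1, hA.2])).2
  have hz : Zf (quadForm A) = fun _ => 0 := by ext x; exact quad_Z hA.1.1 x
  simp only [quad_lap hA.1.1, hA.2, hz] at h
  rw [h]
  simp [J]

/-- The common energy. -/
def alph (n : ℕ) : ℝ := J 2 (fun _ : EE n => (1:ℝ)) / (4 * (n + 6))

lemma Wen_alph {A : Matrix (Fin n) (Fin n) ℝ} (hA : MemP A) : Wen (quadForm A) = alph n := by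
  unfold alph; rw [← Wen_quad hA]; field_simp

section scale
variable {L : ℝ≥0} {z : EE n} {R : ℝ} {u : EE n → ℝ}

lemma resc_zero (h0 : u z = 0) (r : ℝ) : resc u z r 0 = 0 := by simp [resc, h0]

lemma resc_mul (u : EE n → ℝ) (z : EE n) (r t : ℝ) : resc (resc u z r) 0 t = resc u z (t * r) := by
  rw [resc_resc]; simp [mul_comm]

lemma Wen_mono (h : Sol L z R u) (h0 : u z = 0) {r s : ℝ} (hr : 0 < r) (hrs : r ≤ s) (hs : 3 * s ≤ R) :
    Wen (resc u z r) ≤ Wen (resc u z s) := by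
  refine mono_of_quad (f := fun r => Wen (resc u z r)) (C := 400 * L ^ 2 * J 1 (fun _ : EE n => 1)) (r0 := R / 3)
    (mul_nonneg (by positivity) (J_one_nonneg 1)) ?_ hr hrs (by linarith)
  intro r hr t ht ht' hb
  have hv : Sol L 0 3 (resc u z r) := h.resc0 hr (by nlinarith)
  have := weiss_growth hv (resc_zero h0 r) ht ht'
  rw [resc_mul] at this
  have h2 : 0 ≤ J 1 (fun x => Zf (resc u z r) x ^ 2) := J_nonneg fun x _ => sq_nonneg _
  have h3 : 0 ≤ 4 * t * J 1 (fun x => Zf (resc u z r) x ^ 2) := by positivity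
  linarith

lemma Monneau_mono {A : Matrix (Fin n) (Fin n) ℝ} (hA : MemP A) (h : Sol L z R u) (h0 : u z = 0)
    (hW : ∀ r, 0 < r → 3 * r ≤ R → alph n ≤ Wen (resc u z r)) {r s : ℝ} (hr : 0 < r) (hrs : r ≤ s) (hs : 3 * s ≤ R) :
    J 1 (fun x => (resc u z r x - quadForm A x) ^ 2) ≤ J 1 (fun x => (resc u z s x - quadForm A x) ^ 2) := by
  obtain ⟨M, hM0, hM⟩ := quad_bound A
  refine mono_of_quad (f := fun r => J 1 (fun x => (resc u z r x - quadForm A x) ^ 2))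
    (C := 12 * L * (L + M) * J 1 (fun _ : EE n => 1)) (r0 := R / 3)
    (mul_nonneg (by positivity) (J_one_nonneg 1)) ?_ hr hrs (by linarith)
  intro r hr t ht ht' hb
  have hv : Sol L 0 3 (resc u z r) := h.resc0 hr (by nlinarith)
  have := monneau_growth hA hv (resc_zero h0 r) hM (by rw [Wen_alph hA]; exact hW r hr (by nlinarith)) ht ht'
  rw [resc_mul] at this
  exact this

end scale


lemma sup_of_L2 (n : ℕ) {K ε : ℝ} (hK : 0 ≤ K) (hε : 0 < ε) : ∃ η > 0, ∀ f : EE n → ℝ,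
    ContinuousOn f (closedBall 0 1) →
    (∀ x ∈ ball (0 : EE n) 1, ∀ y ∈ ball (0 : EE n) 1, |f x - f y| ≤ K * ‖x - y‖) →
    J 1 (fun x => f x ^ 2) ≤ η → ∀ x ∈ closedBall (0 : EE n) (1 / 2), |f x| ≤ ε := by
  set δ := min (1 / 4) (ε / (2 * (K + 1))) with hδ
  have hδ0 : 0 < δ := by rw [hδ]; positivity
  have hδ1 : δ ≤ 1 / 4 := min_le_left _ _
  have hδ2 : K * δ ≤ ε / 2 := by
    have : δ ≤ ε / (2 * (K + 1)) := min_le_right _ _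
    calc K * δ ≤ (K + 1) * (ε / (2 * (K + 1))) := by gcongr; linarith
      _ = ε / 2 := by field_simp
  set m := (volume (ball (0 : EE n) δ)).toReal with hm
  have hm0 : 0 < m := ENNReal.toReal_pos (measure_ball_pos _ _ hδ0).ne' measure_ball_lt_top.ne
  refine ⟨ε ^ 2 / 32 * m, by positivity, fun f hfc hf hJ x hx => ?_⟩
  by_contra hc
  rw [not_le] at hc
  have hx' : ‖x‖ ≤ 1 / 2 := by simpa using hx
  have hsub : ∀ y ∈ ball x δ, ‖y‖ ≤ 3 / 4 := by
    intro y hy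
    have : ‖y - x‖ < δ := by simpa [dist_eq_norm] using hy
    have := norm_le_norm_add_norm_sub' y x
    linarith
  have hb : ball x δ ⊆ closedBall 0 1 := fun y hy => by
    have := hsub y hy
    simp; linarith
  have hI : JI 1 (fun x => f x ^ 2) := JI.of_cont (by fun_prop)
  have h1 : ∫ y in ball x δ, (ε ^ 2 / 16) ≤ ∫ y in ball x δ, (1 - ‖y‖ ^ 2) ^ 1 * f y ^ 2 := by
    apply setIntegral_mono_on
    · simp [measure_ball_lt_top]
    · exact hI.mono_set hb
    · exact measurableSet_ball
    · intro y hy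
      have hy1 := hsub y hy
      have hyd : ‖x - y‖ ≤ δ := by
        have : ‖y - x‖ < δ := by simpa [dist_eq_norm] using hy
        rw [norm_sub_rev]; exact this.le
      have h2 := hf x (by simp; linarith) y (by simp; linarith)
      have h3 : |f x - f y| ≤ ε / 2 := h2.trans (le_trans (by gcongr) hδ2)
      have h4 : ε / 2 ≤ |f y| := by
        have := abs_sub_abs_le_abs_sub (f x) (f y)
        linarith
      have h5 : (ε / 2) ^ 2 ≤ f y ^ 2 := by rw [← sq_abs (f y)]; gcongr
      have h6 : (1:ℝ) / 4 ≤ 1 - ‖y‖ ^ 2 := by nlinarith [norm_nonneg y]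
      rw [pow_one]
      nlinarith [mul_le_mul h6 h5 (by positivity) (by linarith)]
  have h2 : ∫ y in ball x δ, (1 - ‖y‖ ^ 2) ^ 1 * f y ^ 2 ≤ J 1 (fun x => f x ^ 2) := by
    apply setIntegral_mono_set hI
    · rw [EventuallyLE, ae_restrict_iff' measurableSet_closedBall]
      exact ae_of_all _ fun y hy => mul_nonneg (weight_nonneg hy) (sq_nonneg _)
    · exact hb.eventuallyLE
  rw [setIntegral_const, smul_eq_mul, measureReal_def, Measure.addHaar_ball_center] at h1
  have : 0 < ε ^ 2 * m := by positivity
  have e : (volume (ball (0 : EE n) δ)).toReal * (ε ^ 2 / 16) = ε ^ 2 * m / 16 := by rw [hm]; ring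
  rw [e] at h1
  linarith

/-- Lower bound for the energy at all small scales. -/
def Low (u : EE n → ℝ) (z : EE n) (R : ℝ) : Prop := ∀ r, 0 < r → 3 * r ≤ R → alph n ≤ Wen (resc u z r)

section scale
variable {L : ℝ≥0} {z : EE n} {R : ℝ} {u : EE n → ℝ}

lemma Low_of_near (h : Sol L z R u) (h0 : u z = 0)
    (hn : ∀ ε > 0, ∀ ρ > 0, ∃ r, 0 < r ∧ r < ρ ∧ ∃ A, MemP A ∧
      ∀ x ∈ closedBall (0 : EE n) 1, |resc u z r x - quadForm A x| ≤ ε) : Low u z R := by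
  intro s hs hsR
  have hJ := J_one_pos (n := n) 1
  refine le_of_forall_pos_le_add fun e he => ?_
  obtain ⟨ε, hε, hεe⟩ : ∃ ε > 0, 4 * (ε ^ 2 * J 1 (fun _ : EE n => (1:ℝ))) ≤ e := by
    refine ⟨√(e / (4 * J 1 (fun _ : EE n => (1:ℝ)))), by positivity, ?_⟩
    rw [Real.sq_sqrt (by positivity)]
    field_simp; rfl
  obtain ⟨r, hr, hrs, A, hA, hA2⟩ := hn ε hε s hs
  have hm := Wen_mono h h0 hr hrs.le hsR
  have hv : Sol L 0 2 (resc u z r) := h.resc0 hr (by linarith)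
  have hw := weiss_lower (quad_reg hA.1.1 0 2) hv.reg (by simp [quad_lap hA.1.1, hA.2])
  rw [Wen_alph hA] at hw
  have c1 := hv.v_cont
  have c2 := quad_cont A
  simp only [quad_Z hA.1.1] at hw
  have := J_abs_le (k := 1) (f := fun x => (resc u z r x - quadForm A x) * (0 - (resc u z r x - quadForm A x))) (C := ε ^ 2)
    (JI.of_cont (by fun_prop)) (fun x hx => by
      rw [abs_mul, zero_sub, abs_neg, ← sq]; have := hA2 x hx; gcongr)
  have := (abs_le.1 this).1
  linarith

lemma near_unif {A : Matrix (Fin n) (Fin n) ℝ} (hA : MemP A) (h : Sol L z R u) (h0 : u z = 0) (hR : 0 < R) (hL : Low u z R)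
    (hn : ∀ ε > 0, ∀ ρ > 0, ∃ r, 0 < r ∧ r < ρ ∧
      ∀ x ∈ closedBall (0 : EE n) 1, |resc u z r x - quadForm A x| ≤ ε) :
    ∀ ε > 0, ∃ ρ > 0, ∀ r, 0 < r → r ≤ ρ → ∀ x ∈ closedBall (0 : EE n) (1 / 2), |resc u z r x - quadForm A x| ≤ ε := by
  intro ε hε
  obtain ⟨K, hK⟩ := (quad_reg hA.1.1 (0 : EE n) 2).lipschitz
  obtain ⟨η, hη, H⟩ := sup_of_L2 n (K := L * 2 + K) (by positivity) hε
  have hJ := J_one_pos (n := n) 1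
  obtain ⟨e, he, hee⟩ : ∃ ε > 0, (ε ^ 2 * J 1 (fun _ : EE n => (1:ℝ))) ≤ η := by
    refine ⟨√(η / (J 1 (fun _ : EE n => (1:ℝ)))), by positivity, ?_⟩
    rw [Real.sq_sqrt (by positivity)]
    field_simp; rfl
  obtain ⟨ρ, hρ, hρR, hρ2⟩ := hn e he (R / 3) (by positivity)
  refine ⟨ρ, hρ, fun r hr hrρ x hx => ?_⟩
  have hv : Sol L 0 2 (resc u z r) := h.resc0 hr (by linarith)
  have hv' : Sol L 0 2 (resc u z ρ) := h.resc0 hρ (by linarith)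
  have c1 := hv.v_cont
  have c1' := hv'.v_cont
  have c2 := quad_cont A
  refine H (fun x => resc u z r x - quadForm A x) (by fun_prop) ?_ ?_ x hx
  · intro x hx y hy
    have hx := closedBall_sub_ball2 (ball_subset_closedBall hx)
    have hy := closedBall_sub_ball2 (ball_subset_closedBall hy)
    have h1 := hv.lip_val (resc_zero h0 r) hx hy
    have h2 := hK.dist_le_mul x hx y hy
    rw [Real.dist_eq, dist_eq_norm] at h2
    have : resc u z r x - quadForm A x - (resc u z r y - quadForm A y) = (resc u z r x - resc u z r y) - (quadForm A x - quadForm A y) := by ring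
    rw [this]
    refine (abs_sub _ _).trans ?_
    linarith
  · refine (Monneau_mono hA h h0 hL hr hrρ (by linarith)).trans ?_
    have := J_abs_le (k := 1) (f := fun x => (resc u z ρ x - quadForm A x) ^ 2) (C := e ^ 2)
      (JI.of_cont (by fun_prop)) (fun x hx => by
        rw [abs_pow]; have := hρ2 x hx; gcongr)
    exact (le_abs_self _).trans (this.trans hee)

lemma resc_inv (u : EE n → ℝ) (z x : EE n) {r t : ℝ} (ht : t ≠ 0) :
    resc u z r x = t ^ 2 * resc u z (t * r) (t⁻¹ • x) := by
  unfold resc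
  rw [smul_smul]
  have : t * r * t⁻¹ = r := by field_simp
  rw [this]
  by_cases hr : r = 0
  · simp [hr]
  field_simp

lemma blowup_of_near {A : Matrix (Fin n) (Fin n) ℝ} (hA : MemP A) (h : Sol L z R u) (h0 : u z = 0) (hR : 0 < R) (hL : Low u z R)
    (hn : ∀ ε > 0, ∀ ρ > 0, ∃ r, 0 < r ∧ r < ρ ∧
      ∀ x ∈ closedBall (0 : EE n) 1, |resc u z r x - quadForm A x| ≤ ε) : IsBlowup u z A := by
  refine ⟨hA, ?_⟩
  rw [tendstoLocallyUniformly_iff_forall_isCompact]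
  intro K hK
  obtain ⟨ρ, hρ⟩ := hK.isBounded.subset_closedBall (0 : EE n)
  rw [Metric.tendstoUniformlyOn_iff]
  intro ε hε
  set t := 2 * (|ρ| + 1) with ht
  have htp : 0 < t := by positivity
  obtain ⟨ρ', hρ', H⟩ := near_unif hA h h0 hR hL hn (ε / 2 / t ^ 2) (by positivity)
  have : Ioc (0:ℝ) (ρ' / t) ∈ 𝓝[>] (0:ℝ) := Ioc_mem_nhdsGT (by positivity)
  filter_upwards [this] with r hr x hx
  have hx' : ‖x‖ ≤ ρ := by simpa using hρ hx
  have hx2 : t⁻¹ • x ∈ closedBall (0 : EE n) (1 / 2) := by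
    simp only [mem_closedBall, dist_zero_right, norm_smul, norm_inv, Real.norm_of_nonneg htp.le]
    rw [inv_mul_le_iff₀ htp, ht]
    linarith [le_abs_self ρ]
  have h1 := H (t * r) (by have := hr.1; positivity) (by have := hr.2; rw [le_div_iff₀ htp] at this; linarith) _ hx2
  change dist (quadForm A x) (resc u z r x) < ε
  have e : quadForm A x = t ^ 2 * quadForm A (t⁻¹ • x) := by rw [quad_smul]; field_simp
  rw [resc_inv u z x htp.ne', e, dist_comm, Real.dist_eq, ← mul_sub, abs_mul, abs_of_pos (by positivity : 0 < t ^ 2)]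
  rw [le_div_iff₀ (by positivity)] at h1
  linarith

lemma near_of_blowup {A : Matrix (Fin n) (Fin n) ℝ} (h : IsBlowup u z A) : ∀ ε > 0, ∀ ρ > 0, ∃ r, 0 < r ∧ r < ρ ∧
      ∀ x ∈ closedBall (0 : EE n) 1, |resc u z r x - quadForm A x| ≤ ε := by
  intro ε hε ρ hρ
  have h1 := (tendstoLocallyUniformly_iff_forall_isCompact.1 h.2) _ (isCompact_closedBall (0 : EE n) 1)
  rw [Metric.tendstoUniformlyOn_iff] at h1
  obtain ⟨r, hr, hr2⟩ := ((h1 ε hε).and (Ioo_mem_nhdsGT hρ)).exists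
  refine ⟨r, hr2.1, hr2.2, fun x hx => ?_⟩
  have := hr x hx
  rw [dist_comm, Real.dist_eq] at this
  exact this.le

lemma blow_dist {A B : Matrix (Fin n) (Fin n) ℝ} (hA : IsBlowup u z A) (hB : MemP B) (h : Sol L z R u) (h0 : u z = 0)
    (hL : Low u z R) {r : ℝ} (hr : 0 < r) (hrR : 3 * r ≤ R) :
    J 1 (fun x => (quadForm A x - quadForm B x) ^ 2) ≤ J 1 (fun x => (resc u z r x - quadForm B x) ^ 2) := by
  obtain ⟨MA, hMA0, hMA⟩ := quad_bound A
  obtain ⟨MB, hMB0, hMB⟩ := quad_bound B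
  have hJ := J_one_pos (n := n) 1
  set C := 2 * (MA + MB + 1) * J 1 (fun _ : EE n => (1:ℝ)) with hC
  have hCp : 0 < C := by positivity
  refine le_of_forall_pos_le_add fun e he => ?_
  obtain ⟨s, hs, hsr, H⟩ := near_of_blowup hA (e / C) (by positivity) r hr
  have hv : Sol L 0 2 (resc u z s) := h.resc0 hs (by linarith)
  have c1 := hv.v_cont
  have c2 := quad_cont A
  have c3 := quad_cont B
  have hm := Monneau_mono hB h h0 hL hs hsr.le hrR
  have : J 1 (fun x => (quadForm A x - quadForm B x) ^ 2) ≤ J 1 (fun x => (resc u z s x - quadForm B x) ^ 2)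
      + (2 * (e / C) * (MA + MB)) * J 1 (fun _ : EE n => (1:ℝ)) := by
    rw [← J_smul, ← J_add]
    · apply J_mono
      · exact JI.of_cont (by fun_prop)
      · exact JI.of_cont (by fun_prop)
      · intro x hx
        have h1 := H x hx
        have h2 : |quadForm A x - quadForm B x| ≤ MA + MB := (abs_sub _ _).trans (add_le_add (hMA x hx) (hMB x hx))
        set p := quadForm A x - quadForm B x with hp
        set d := resc u z s x - quadForm A x with hd
        have e1 : resc u z s x - quadForm B x = p + d := by rw [hp, hd]; ring
        rw [e1]
        have h3 : |d * p| ≤ (e / C) * (MA + MB) := by rw [abs_mul]; gcongr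
        have := (abs_le.1 h3).1
        nlinarith [sq_nonneg d]
    all_goals exact JI.of_cont (by fun_prop)
  have h5 : (2 * (e / C) * (MA + MB)) * J 1 (fun _ : EE n => (1:ℝ)) ≤ e := by
    calc (2 * (e / C) * (MA + MB)) * J 1 (fun _ : EE n => (1:ℝ)) ≤ (2 * (e / C) * (MA + MB + 1)) * J 1 (fun _ : EE n => (1:ℝ)) := by
          exact mul_le_mul_of_nonneg_right (mul_le_mul_of_nonneg_left (by linarith) (by positivity)) hJ.le
      _ = e / C * C := by rw [hC]; ring
      _ = e := by field_simp
  linarith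

end scale

/-- Polarization for symmetric matrices. -/
lemma quad_polar {A : Matrix (Fin n) (Fin n) ℝ} (hA : A.IsHermitian) (i j : Fin n) :
    A i j = quadForm A (EuclideanSpace.single i 1 + EuclideanSpace.single j 1)
      - quadForm A (EuclideanSpace.single i 1) - quadForm A (EuclideanSpace.single j 1) := by
  simp only [quad_eq, map_add, inner_add_left, inner_add_right]
  rw [TA_symm hA (EuclideanSpace.single i 1) (EuclideanSpace.single j 1)]
  have : inner ℝ (TA A (EuclideanSpace.single j (1:ℝ))) (EuclideanSpace.single i (1:ℝ)) = A i j := by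
    rw [EuclideanSpace.inner_single_right, TA_apply]; simp
  rw [this]; ring

/-- Entries are controlled by values on the half ball. -/
lemma quad_entries {A B : Matrix (Fin n) (Fin n) ℝ} (hA : A.IsHermitian) (hB : B.IsHermitian) {ε : ℝ}
    (h : ∀ x ∈ closedBall (0 : EE n) (1 / 2), |quadForm A x - quadForm B x| ≤ ε) (i j : Fin n) : |A i j - B i j| ≤ 48 * ε := by
  have hs : ∀ x : EE n, ‖x‖ ≤ 2 → |quadForm A x - quadForm B x| ≤ 16 * ε := by
    intro x hx
    have h1 := h ((1 / 4 : ℝ) • x) (by simp only [mem_closedBall, dist_zero_right, norm_smul]; norm_num; linarith)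
    rw [quad_smul, quad_smul, ← mul_sub, abs_mul] at h1
    norm_num at h1
    linarith
  have n1 : ∀ i : Fin n, ‖(EuclideanSpace.single i 1 : EE n)‖ = 1 := fun i => by simp
  have a1 := hs (EuclideanSpace.single i 1 + EuclideanSpace.single j 1) ((norm_add_le _ _).trans (by rw [n1, n1]; norm_num))
  have a2 := hs (EuclideanSpace.single i 1) (by rw [n1]; norm_num)
  have a3 := hs (EuclideanSpace.single j 1) (by rw [n1]; norm_num)
  rw [quad_polar hA, quad_polar hB]
  rw [abs_le] at *
  constructor <;> linarith [a1.1, a1.2, a2.1, a2.2, a3.1, a3.2]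


section scale
variable {L : ℝ≥0} {z y : EE n} {R : ℝ} {u : EE n → ℝ}

lemma Low_closed (h : Sol L y R u) (hy : ∀ δ > 0, ∃ x, dist x y < δ ∧ u x = 0 ∧ Low u x (R / 2)) :
    Low u y (R / 2) := by
  intro r hr hrR
  have hR : 0 < R := by linarith
  obtain ⟨K, hK⟩ := h.reg.lipschitz
  have hJ := J_one_pos (n := n) 1
  have lim : Tendsto (fun δ : ℝ => alph n - 4 * ((K * δ / r ^ 2) * (3 * L + K * δ / r ^ 2) * J 1 (fun _ : EE n => (1:ℝ)))) (𝓝[>] 0)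
      (𝓝 (alph n)) := by
    have : Tendsto (fun δ : ℝ => alph n - 4 * ((K * δ / r ^ 2) * (3 * L + K * δ / r ^ 2) * J 1 (fun _ : EE n => (1:ℝ)))) (𝓝 0)
      (𝓝 (alph n - 4 * ((K * 0 / r ^ 2) * (3 * L + K * 0 / r ^ 2) * J 1 (fun _ : EE n => (1:ℝ))))) :=
      Continuous.tendsto (by fun_prop) 0
    simp at this
    exact (by simpa using this.mono_left nhdsWithin_le_nhds)
  refine le_of_tendsto lim ?_
  filter_upwards [Ioo_mem_nhdsGT (show (0:ℝ) < R / 2 by linarith)] with δ hδ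
  obtain ⟨x, hx, hx0, hLx⟩ := hy δ hδ.1
  have hsx : Sol L x (R / 2) u := h.mono le_rfl (ball_subset_ball' (by linarith [hδ.2]))
  have hv1 : Sol L 0 2 (resc u x r) := hsx.resc0 hr (by linarith)
  have hv2 : Sol L 0 2 (resc u y r) := h.resc0 hr (by linarith)
  have hw := weiss_lower hv1.reg hv2.reg (sol_sign hv1 fun x hx => hv2.nonneg x (closedBall_sub_ball2 hx))
  have h1 := hLx r hr hrR
  have c1 := hv1.v_cont
  have c2 := hv2.v_cont
  have c3 := hv1.Z_cont
  have hd : ∀ w ∈ closedBall (0 : EE n) 1, |resc u y r w - resc u x r w| ≤ K * δ / r ^ 2 := by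
    intro w hw
    have hw1 := norm_le_of_cb hw
    have hnw : ‖r • w‖ ≤ r := by
      rw [norm_smul, Real.norm_of_nonneg hr.le]; nlinarith
    have m1 : y + r • w ∈ ball y R := by
      rw [mem_ball, dist_eq_norm]; simp only [add_sub_cancel_left]; linarith
    have m2 : x + r • w ∈ ball y R := by
      rw [mem_ball]
      calc dist (x + r • w) y ≤ dist (x + r • w) x + dist x y := dist_triangle _ _ _
        _ < R := by rw [dist_eq_norm, add_sub_cancel_left]; linarith [hδ.2]
    have := hK.dist_le_mul _ m1 _ m2
    rw [dist_add_right, Real.dist_eq, dist_comm] at this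
    unfold resc
    rw [← sub_div, abs_div, abs_of_pos (by positivity : 0 < r ^ 2)]
    gcongr
    exact this.trans (by gcongr)
  have := J_abs_le (k := 1) (f := fun w => (resc u y r w - resc u x r w) * (Zf (resc u x r) w - (resc u y r w - resc u x r w)))
    (C := (K * δ / r ^ 2) * (3 * L + K * δ / r ^ 2)) (JI.of_cont (by fun_prop)) (fun w hw => by
      rw [abs_mul]
      have a1 := hd w hw
      have a2 := hv1.Z_le (resc_zero hx0 r) hw
      have a3 := (abs_sub (Zf (resc u x r) w) (resc u y r w - resc u x r w))
      have : 0 ≤ K * δ / r ^ 2 := by have := hδ.1; positivity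
      gcongr
      linarith)
  have := (abs_le.1 this).1
  linarith

lemma contact_small {v : EE n → ℝ} (h : Sol L 0 2 v) (h0 : v 0 = 0) (hW : alph n ≤ Wen v) {l : ℝ} (hl : 0 < l)
    (hZ : J 1 (fun x => Zf v x ^ 2) ≤ l ^ 2) :
    J 2 (fun _ : EE n => (1:ℝ)) - (6 + 8 * (n + 6) * L) * (J 1 (fun _ : EE n => (1:ℝ)) + 1) * l ≤ J 2 (fun x => lapGrad v x) := by
  have h1 := (contact_eq h.reg (by
    filter_upwards [h.lap] with x hx hxB
    rw [hx (closedBall_sub_ball2 hxB)]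
    split_ifs with hc
    · ring
    · have : v x = 0 := le_antisymm (not_lt.1 hc) (h.nonneg x (closedBall_sub_ball2 hxB))
      rw [this]; ring)).2
  have c1 := h.v_cont
  have c3 := h.Z_cont
  have hJ := J_one_pos (n := n) 1
  have i1 : ∀ z : ℝ, |z| ≤ l + l⁻¹ * z ^ 2 := by
    intro z
    have e : l + l⁻¹ * z ^ 2 - |z| = l⁻¹ * ((|z| - l / 2) ^ 2 + 3 / 4 * l ^ 2) := by
      rw [← sq_abs z]; field_simp; ring
    have : 0 ≤ l⁻¹ * ((|z| - l / 2) ^ 2 + 3 / 4 * l ^ 2) := by positivity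
    linarith
  have w12 : ∀ f : EE n → ℝ, ContinuousOn f (closedBall 0 1) → (∀ x, 0 ≤ f x) → J 2 f ≤ J 1 f := by
    intro f hf hf0
    apply setIntegral_mono_on (JI.of_cont (k := 2) hf) (JI.of_cont (k := 1) hf) measurableSet_closedBall
    intro x hx
    have hx1 := norm_le_of_cb hx
    have : (1 - ‖x‖^2)^2 ≤ (1 - ‖x‖^2)^1 := pow_le_pow_of_le_one (by nlinarith [norm_nonneg x]) (by nlinarith [norm_nonneg x]) (by norm_num)
    exact mul_le_mul_of_nonneg_right this (hf0 x)
  have b1 : J 1 (fun x => |Zf v x|) ≤ (J 1 (fun _ : EE n => (1:ℝ)) + 1) * l := by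
    have : J 1 (fun x => |Zf v x|) ≤ J 1 (fun x => l * 1 + l⁻¹ * Zf v x ^ 2) :=
      J_mono (JI.of_cont (by fun_prop)) (JI.of_cont (by fun_prop)) (fun x _ => by rw [mul_one]; exact i1 _)
    rw [J_add (JI.of_cont (by fun_prop)) (JI.of_cont (by fun_prop)), J_smul, J_smul] at this
    have h2 : l⁻¹ * J 1 (fun x => Zf v x ^ 2) ≤ l := by
      rw [inv_mul_le_iff₀ hl]; linarith
    linarith
  have b2 := w12 (fun x => |Zf v x|) (by fun_prop) (fun x => abs_nonneg _)
  have b3 : -J 1 (fun x => |Zf v x|) ≤ J 1 (Zf v) := by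
    rw [← neg_one_mul, ← J_smul]
    exact J_mono (JI.of_cont (by fun_prop)) (JI.of_cont (by fun_prop)) (fun x _ => by linarith [neg_abs_le (Zf v x)])
  have b4 : -J 2 (fun x => |Zf v x|) ≤ J 2 (Zf v) := by
    rw [← neg_one_mul, ← J_smul]
    exact J_mono (JI.of_cont (by fun_prop)) (JI.of_cont (by fun_prop)) (fun x _ => by linarith [neg_abs_le (Zf v x)])
  have b5 : J 1 (fun x => v x * Zf v x) ≤ L * J 1 (fun x => |Zf v x|) := by
    rw [← J_smul]
    refine J_mono (JI.of_cont (by fun_prop)) (JI.of_cont (by fun_prop)) (fun x hx => ?_)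
    refine (le_abs_self _).trans ?_
    rw [abs_mul]
    have := h.v_le h0 hx
    gcongr
  have b6 : 4 * (n + 6) * alph n = J 2 (fun _ : EE n => (1:ℝ)) := by unfold alph; field_simp
  have b7 : 4 * (n + 6) * alph n ≤ 4 * (n + 6) * Wen v := by gcongr
  have b8 : 8 * (n + 6) * J 1 (fun x => v x * Zf v x) ≤ 8 * (n + 6) * L * ((J 1 (fun _ : EE n => (1:ℝ)) + 1) * l) := by
    rw [mul_assoc (8 * ((n:ℝ) + 6)) L]
    gcongr
    exact b5.trans (by gcongr)
  rw [h1]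
  linarith

lemma contact_lim (h : Sol L z R u) (h0 : u z = 0) (hR : 0 < R) (hL : Low u z R) {ε : ℝ} (hε : 0 < ε) :
    ∃ ρ > 0, ∀ r, 0 < r → r ≤ ρ → J 2 (fun _ : EE n => (1:ℝ)) - ε ≤ J 2 (fun x => lapGrad (resc u z r) x) := by
  have hJ := J_one_pos (n := n) 1
  set C1 := (6 + 8 * ((n:ℝ) + 6) * L) * (J 1 (fun _ : EE n => (1:ℝ)) + 1) with hC1
  have hC1p : 0 < C1 := by positivity
  set l := ε / C1 with hl
  have hlp : 0 < l := by positivity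
  set C := 400 * (L:ℝ) ^ 2 * J 1 (fun _ : EE n => (1:ℝ)) with hC
  have hCp : 0 ≤ C := by positivity
  set t := min (1 / 2) (l ^ 2 / (1 + C)) with ht
  have htp : 0 < t := by rw [ht]; positivity
  have ht1 : t ≤ 1 / 2 := min_le_left _ _
  have ht2 : t * (1 + C) ≤ l ^ 2 := by
    have : t ≤ l ^ 2 / (1 + C) := min_le_right _ _
    rwa [le_div_iff₀ (by positivity)] at this
  set S := (fun r => Wen (resc u z r)) '' Ioc 0 (R / 3) with hS
  have hSb : BddBelow S := ⟨alph n, by rintro _ ⟨r, hr, rfl⟩; exact hL r hr.1 (by linarith [hr.2])⟩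
  have hSn : S.Nonempty := ⟨_, R / 3, ⟨by positivity, le_rfl⟩, rfl⟩
  obtain ⟨_, ⟨r1, hr1, rfl⟩, hr1S⟩ := exists_lt_of_csInf_lt hSn (show sInf S < sInf S + t ^ 2 by linarith [sq_pos_of_pos htp])
  refine ⟨r1 / 2, by have := hr1.1; positivity, fun r hr hrr => ?_⟩
  have hr2 := hr1.2
  have hv3 : Sol L 0 3 (resc u z r) := h.resc0 hr (by linarith)
  have g := weiss_growth hv3 (resc_zero h0 r) htp.le ht1
  rw [resc_mul] at g
  have m1 : Wen (resc u z ((1 + t) * r)) ≤ Wen (resc u z r1) :=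
    Wen_mono h h0 (by positivity) (by nlinarith) (by linarith)
  have m2 : sInf S ≤ Wen (resc u z r) := csInf_le hSb ⟨r, ⟨hr, by linarith⟩, rfl⟩
  have hZ : J 1 (fun x => Zf (resc u z r) x ^ 2) ≤ l ^ 2 := by
    have h5 : 4 * t * J 1 (fun x => Zf (resc u z r) x ^ 2) ≤ 4 * t * l ^ 2 := by
      have : 4 * t * J 1 (fun x => Zf (resc u z r) x ^ 2) ≤ t * (t * (1 + C)) := by
        simp only at hr1S
        nlinarith
      have h6 : t * (t * (1 + C)) ≤ t * l ^ 2 := by gcongr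
      nlinarith [mul_nonneg htp.le (sq_nonneg l)]
    exact le_of_mul_le_mul_left h5 (by positivity)
  have := contact_small hv3.two (resc_zero h0 r) (hL r hr (by linarith)) hlp hZ
  have e : C1 * l = ε := by rw [hl]; field_simp
  rw [← hC1, e] at this
  exact this

end scale

/-- The contact set in the ball of radius `ρ`. -/
def Kset (v : EE n → ℝ) (ρ : ℝ) : Set (EE n) := closedBall 0 ρ ∩ {x | v x ≤ 0}

lemma Kset_meas {L : ℝ≥0} {v : EE n → ℝ} (h : Sol L 0 2 v) {ρ : ℝ} (hρ : ρ ≤ 1) : MeasurableSet (Kset v ρ) := by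
  have c := (h.v_cont).mono (closedBall_subset_closedBall hρ)
  exact (c.preimage_isClosed_of_isClosed isClosed_closedBall isClosed_Iic).measurableSet

lemma contact_int {L : ℝ≥0} {v : EE n → ℝ} (h : Sol L 0 2 v) (k : ℕ) :
    J k (fun _ : EE n => (1:ℝ)) - J k (fun x => lapGrad v x) = ∫ x in Kset v 1, (1 - ‖x‖ ^ 2) ^ k := by
  have hm := Kset_meas h le_rfl
  have hae : ∀ᵐ x, x ∈ closedBall (0 : EE n) 1 → 1 - (Kset v 1).indicator (fun _ => (1:ℝ)) x = lapGrad v x := by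
    filter_upwards [h.lap] with x hx hxB
    rw [hx (closedBall_sub_ball2 hxB)]
    by_cases hc : 0 < v x
    · rw [indicator_of_notMem (fun hh => absurd hh.2 (not_le.2 hc)), if_pos hc]; ring
    · rw [indicator_of_mem (show x ∈ Kset v 1 from ⟨hxB, not_lt.1 hc⟩), if_neg hc]; ring
  have h1 : JI k (fun _ : EE n => (1:ℝ)) := JI.of_cont (by fun_prop)
  have e : ∀ x : EE n, (1 - ‖x‖ ^ 2) ^ k * (Kset v 1).indicator (fun _ => (1:ℝ)) x = (Kset v 1).indicator (fun x => (1 - ‖x‖ ^ 2) ^ k) x := by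
    intro x
    by_cases hx : x ∈ Kset v 1 <;> simp [hx]
  have h2 : JI k ((Kset v 1).indicator (fun _ => (1:ℝ))) := by
    unfold JI
    simp_rw [e]
    have : IntegrableOn (fun x : EE n => (1 - ‖x‖ ^ 2) ^ k) (closedBall 0 1) := by
      refine Integrable.congr h1 (ae_of_all _ fun x => by simp)
    exact this.indicator hm
  rw [← J_congr_ae hae, J_sub h1 h2, sub_sub_cancel]
  unfold J
  simp_rw [e]
  rw [setIntegral_indicator hm]
  congr 2
  exact inter_eq_right.2 inter_subset_left

lemma Kset_fin (v : EE n → ℝ) (ρ : ℝ) : volume (Kset v ρ) ≠ ∞ :=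
  ((measure_mono inter_subset_left).trans_lt measure_closedBall_lt_top).ne

lemma wt_intOn (k : ℕ) (v : EE n → ℝ) (ρ : ℝ) : IntegrableOn (fun x : EE n => (1 - ‖x‖ ^ 2) ^ k) (Kset v ρ) := by
  refine IntegrableOn.mono_set ?_ (show Kset v ρ ⊆ closedBall 0 ρ from inter_subset_left)
  exact ContinuousOn.integrableOn_compact (isCompact_closedBall _ _) (by fun_prop)

lemma contact_vol_half {L : ℝ≥0} {v : EE n → ℝ} (h : Sol L 0 2 v) :
    9 / 16 * volume.real (Kset v (1 / 2)) ≤ J 2 (fun _ : EE n => (1:ℝ)) - J 2 (fun x => lapGrad v x) := by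
  rw [contact_int h]
  have hs : Kset v (1 / 2) ⊆ Kset v 1 := inter_subset_inter_left _ (closedBall_subset_closedBall (by norm_num))
  calc 9 / 16 * volume.real (Kset v (1 / 2)) = ∫ x in Kset v (1 / 2), (9 / 16 : ℝ) := by
        rw [setIntegral_const, smul_eq_mul, mul_comm]
    _ ≤ ∫ x in Kset v (1 / 2), (1 - ‖x‖ ^ 2) ^ 2 := by
        apply setIntegral_mono_on
        · exact integrableOn_const (Kset_fin v (1 / 2))
        · exact wt_intOn _ _ _
        · exact Kset_meas h (by norm_num)
        · intro x hx
          have : ‖x‖ ≤ 1 / 2 := by simpa using hx.1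
          have : 3 / 4 ≤ 1 - ‖x‖ ^ 2 := by nlinarith [norm_nonneg x]
          nlinarith
    _ ≤ _ := by
        apply setIntegral_mono_set (wt_intOn _ _ _) _ hs.eventuallyLE
        rw [EventuallyLE, ae_restrict_iff' (Kset_meas h le_rfl)]
        exact ae_of_all _ fun x hx => weight_nonneg hx.1

lemma contact_vol_one {L : ℝ≥0} {v : EE n → ℝ} (h : Sol L 0 2 v) (k : ℕ) :
    0 ≤ J k (fun _ : EE n => (1:ℝ)) - J k (fun x => lapGrad v x) ∧
    J k (fun _ : EE n => (1:ℝ)) - J k (fun x => lapGrad v x) ≤ volume.real (Kset v 1) := by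
  rw [contact_int h]
  constructor
  · exact setIntegral_nonneg (Kset_meas h le_rfl) fun x hx => weight_nonneg hx.1
  · calc ∫ x in Kset v 1, (1 - ‖x‖ ^ 2) ^ k ≤ ∫ x in Kset v 1, (1:ℝ) := by
          apply setIntegral_mono_on (wt_intOn _ _ _)
          · simp [(Kset_fin v 1).lt_top]
          · exact Kset_meas h le_rfl
          · exact fun x hx => weight_le_one hx.1
      _ = _ := by simp

lemma Kset_scale (v : EE n → ℝ) (x : EE n) {t : ℝ} (ht : 0 < t) (hx : ‖x‖ + t ≤ 1 / 2) :
    volume.real (Kset (resc v x t) 1) ≤ (t ^ n)⁻¹ * volume.real (Kset v (1 / 2)) := by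
  have hs : Kset (resc v x t) 1 ⊆ (t • ·) ⁻¹' ((fun y => x + y) ⁻¹' (Kset v (1 / 2))) := by
    intro y hy
    have hy1 : ‖y‖ ≤ 1 := by simpa using hy.1
    refine ⟨?_, ?_⟩
    · simp only [mem_closedBall, dist_zero_right]
      refine (norm_add_le _ _).trans ?_
      rw [norm_smul, Real.norm_of_nonneg ht.le]
      nlinarith
    · have h2 : resc v x t y ≤ 0 := hy.2
      unfold resc at h2
      rw [div_le_iff₀ (by positivity), zero_mul] at h2
      exact h2
  have e : volume ((t • ·) ⁻¹' ((fun y => x + y) ⁻¹' (Kset v (1 / 2)))) = ENNReal.ofReal (t ^ n)⁻¹ * volume (Kset v (1 / 2)) := by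
    rw [Measure.addHaar_preimage_smul _ ht.ne', measure_preimage_add, finrank_euclideanSpace_fin, abs_of_pos (by positivity)]
  unfold Measure.real
  calc _ ≤ (ENNReal.ofReal (t ^ n)⁻¹ * volume (Kset v (1 / 2))).toReal := by
        rw [← e]
        apply ENNReal.toReal_mono _ (measure_mono hs)
        rw [e]; exact ENNReal.mul_ne_top ENNReal.ofReal_ne_top (Kset_fin _ _)
    _ = _ := by rw [ENNReal.toReal_mul, ENNReal.toReal_ofReal (by positivity)]


lemma wt_cont (k : ℕ) : Continuous (wt (n := n) k) := by unfold wt; fun_prop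

lemma J_eq_wt (k : ℕ) (f : EE n → ℝ) : J (k + 1) f = ∫ x, wt (k + 1) x * f x := by
  rw [← setIntegral_eq_integral_of_forall_compl_eq_zero (s := closedBall (0 : EE n) 1)]
  · apply setIntegral_congr_fun measurableSet_closedBall
    intro x hx
    simp only [wt_eq hx]
  · intro x hx
    rw [wt_zero (by simpa using hx), zero_mul]

lemma avg_const {F : EE n → ℝ} (hF : Continuous F) {C : ℝ} (hC : ∀ x, |F x| ≤ C)
    (hm : ∀ x : EE n, ∀ t : ℝ, 0 < t → J 2 (fun y => F (x + t • y)) = F x * J 2 (fun _ : EE n => (1:ℝ))) (x : EE n) : F x = F 0 := by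
  obtain ⟨K0, hK0⟩ := wt_lip_on (n := n) 2
  obtain ⟨K, hK⟩ := lip_glob le_rfl hK0 (fun x hx => wt_zero hx)
  have hJ := J_one_pos (n := n) 2
  have hC0 : 0 ≤ C := (abs_nonneg _).trans (hC 0)
  set V := volume.real (closedBall (0 : EE n) 2) with hV
  have key : ∀ t : ℝ, 0 < t → ‖x‖ ≤ t → |F x - F 0| * J 2 (fun _ : EE n => (1:ℝ)) ≤ (K * ‖x‖ * C * V) / t := by
    intro t ht hxt
    set a := t⁻¹ • x with ha
    have han : ‖a‖ = ‖x‖ / t := by rw [ha, norm_smul, norm_inv, Real.norm_of_nonneg ht.le]; field_simp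
    have ha1 : ‖a‖ ≤ 1 := by rw [han, div_le_one ht]; exact hxt
    have hta : t • a = x := by rw [ha, smul_smul, mul_inv_cancel₀ ht.ne', one_smul]
    have e1 : F x * J 2 (fun _ : EE n => (1:ℝ)) = ∫ y, wt 2 (y - a) * F (t • y) := by
      rw [← hm x t ht, J_eq_wt, ← integral_sub_right_eq_self _ a]
      congr 1; ext y
      rw [smul_sub, hta]; congr 2; abel
    have e2 : F 0 * J 2 (fun _ : EE n => (1:ℝ)) = ∫ y, wt 2 y * F (t • y) := by
      rw [← hm 0 t ht, J_eq_wt]; simp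
    have z1 : ∀ y, y ∉ closedBall (0 : EE n) 2 → wt 2 (y - a) * F (t • y) = 0 := by
      intro y hy
      have hy2 : 2 < ‖y‖ := by simpa using hy
      have : 1 < ‖y - a‖ := by
        have := norm_sub_norm_le y a
        linarith
      rw [wt_zero this, zero_mul]
    have z2 : ∀ y, y ∉ closedBall (0 : EE n) 2 → wt 2 y * F (t • y) = 0 := by
      intro y hy
      have hy2 : 2 < ‖y‖ := by simpa using hy
      rw [wt_zero (by linarith), zero_mul]
    have w := wt_cont (n := n) 2
    rw [← setIntegral_eq_integral_of_forall_compl_eq_zero z1] at e1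
    rw [← setIntegral_eq_integral_of_forall_compl_eq_zero z2] at e2
    have i1 : IntegrableOn (fun y => wt 2 (y - a) * F (t • y)) (closedBall (0 : EE n) 2) :=
      ContinuousOn.integrableOn_compact (isCompact_closedBall _ _) (by fun_prop)
    have i2 : IntegrableOn (fun y => wt 2 y * F (t • y)) (closedBall (0 : EE n) 2) :=
      ContinuousOn.integrableOn_compact (isCompact_closedBall _ _) (by fun_prop)
    have e3 : (F x - F 0) * J 2 (fun _ : EE n => (1:ℝ)) =
        ∫ y in closedBall (0 : EE n) 2, (wt 2 (y - a) * F (t • y) - wt 2 y * F (t • y)) := by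
      rw [integral_sub i1 i2, ← e1, ← e2]; ring
    have e4 : |F x - F 0| * J 2 (fun _ : EE n => (1:ℝ)) = |(F x - F 0) * J 2 (fun _ : EE n => (1:ℝ))| := by
      rw [abs_mul, abs_of_pos hJ]
    rw [e4, e3]
    have := norm_setIntegral_le_of_norm_le_const (C := K * ‖a‖ * C) (μ := volume) (s := closedBall (0 : EE n) 2)
      (f := fun y => wt 2 (y - a) * F (t • y) - wt 2 y * F (t • y)) measure_closedBall_lt_top (fun y _ => by
        rw [← sub_mul, norm_mul]
        have h1 := hK.dist_le_mul (y - a) y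
        rw [dist_eq_norm, dist_eq_norm] at h1
        have h2 : ‖y - a - y‖ = ‖a‖ := by rw [sub_sub_cancel_left, norm_neg]
        rw [h2] at h1
        have h3 := hC (t • y)
        rw [Real.norm_eq_abs (F _)]
        gcongr)
    rw [Real.norm_eq_abs] at this
    refine this.trans (le_of_eq ?_)
    rw [han]; field_simp; rfl
  have lim : Tendsto (fun t : ℝ => (K * ‖x‖ * C * V) / t) atTop (𝓝 0) := tendsto_const_nhds.div_atTop tendsto_id
  have := ge_of_tendsto lim (by
    filter_upwards [eventually_gt_atTop 0, eventually_ge_atTop ‖x‖] with t h1 h2 using key t h1 h2)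
  have h3 : |F x - F 0| ≤ 0 := by
    by_contra hc
    exact absurd this (not_le.2 (mul_pos (not_le.1 hc) hJ))
  have := abs_nonpos_iff.1 h3
  linarith

lemma liouville {v : EE n → ℝ} {L : ℝ} (hc : Continuous v) (hnn : ∀ x, 0 ≤ v x) (hb : ∀ x, |v x| ≤ L * ‖x‖ ^ 2)
    (h2 : ∀ a b : EE n, ∃ C, ∀ x, |v (x + a + b) - v (x + a) - v (x + b) + v x| ≤ C)
    (hm : ∀ x : EE n, ∀ t : ℝ, 0 < t → J 2 (fun y => v (x + t • y)) = v x * J 2 (fun _ : EE n => (1:ℝ)) + J 3 (fun _ : EE n => (1:ℝ)) / 12 * t ^ 2) :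
    ∃ A : Matrix (Fin n) (Fin n) ℝ, MemP A ∧ v = quadForm A := by
  have hv0 : v 0 = 0 := by simpa using hb 0
  have hF : ∀ a b x : EE n, v (x + a + b) - v (x + a) - v (x + b) + v x = v (a + b) - v a - v b := by
    intro a b x
    obtain ⟨C, hC⟩ := h2 a b
    have := avg_const (F := fun x => v (x + a + b) - v (x + a) - v (x + b) + v x) (by fun_prop) hC ?_ x
    · rw [this]; simp [hv0]
    · intro x t ht
      have e : ∀ w : EE n, J 2 (fun y => v (x + t • y + w)) = v (x + w) * J 2 (fun _ : EE n => (1:ℝ)) + J 3 (fun _ : EE n => (1:ℝ)) / 12 * t ^ 2 := by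
        intro w
        rw [← hm (x + w) t ht]
        congr 1; ext y; congr 1; abel
      have e0 := hm x t ht
      have e1 := e a
      have e2 := e b
      have e3 := e (a + b)
      simp only [← add_assoc] at e3
      rw [J_add, J_sub, J_sub, e3, e2, e1, e0]
      · ring
      all_goals exact JI.of_cont (by fun_prop)
  set B : EE n → EE n → ℝ := fun a b => v (a + b) - v a - v b with hB
  have Bsymm : ∀ a b, B a b = B b a := by intro a b; simp only [hB, add_comm a b]; ring
  have Badd : ∀ x a b, B (x + a) b = B x b + B a b := by
    intro x a b
    have := hF a b x
    simp only [hB]; linarith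
  -- real-linearity in the first variable
  have Bsmul : ∀ (c : ℝ) a b, B (c • a) b = c * B a b := by
    intro c a b
    let φ : EE n →+ ℝ := AddMonoidHom.mk' (fun a => B a b) (fun x y => Badd x y b)
    have hφ : Continuous φ := by
      change Continuous (fun a => v (a + b) - v a - v b)
      fun_prop
    have := map_real_smul φ hφ c a
    simpa [φ] using this
  have Badd' : ∀ x a b, B b (x + a) = B b x + B b a := fun x a b => by
    rw [Bsymm, Badd, Bsymm x, Bsymm a]
  have Bsmul' : ∀ (c : ℝ) a b, B b (c • a) = c * B b a := fun c a b => by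
    rw [Bsymm, Bsmul, Bsymm a]
  let Bl : EE n →ₗ[ℝ] EE n →ₗ[ℝ] ℝ := LinearMap.mk₂ ℝ B (fun x a b => Badd x a b) (fun c a b => Bsmul c a b)
    (fun b x a => Badd' x a b) (fun c b a => Bsmul' c a b)
  have hBl : ∀ a b, Bl a b = B a b := fun a b => rfl
  -- v is half the diagonal
  have hdiag : ∀ x, v x = 1 / 2 * B x x := by
    intro x
    let g : EE n → ℝ := fun x => v x - 1 / 2 * B x x
    have gadd : ∀ a b, g (a + b) = g a + g b := by
      intro a b
      have e : v (a + b) = v a + v b + B a b := by simp only [hB]; ring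
      simp only [g]
      rw [Badd, Badd', Badd', e, Bsymm b a]; ring
    let φ : EE n →+ ℝ := AddMonoidHom.mk' g gadd
    have hφ : Continuous φ := by
      change Continuous (fun x => v x - 1 / 2 * (v (x + x) - v x - v x))
      fun_prop
    have gsm : ∀ (c : ℝ) a, g (c • a) = c * g a := fun c a => map_real_smul φ hφ c a
    have gb : ∀ a, |g a| ≤ (4 * L) * ‖a‖ ^ 2 := by
      intro a
      have e : g a = 2 * v a - 1 / 2 * v (a + a) := by simp only [g, hB]; ring
      have h1 := hb a
      have h2 := hb (a + a)
      have : ‖a + a‖ = 2 * ‖a‖ := by rw [← two_smul ℝ a, norm_smul]; norm_num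
      rw [this] at h2
      rw [e, abs_le]
      rw [abs_le] at h1 h2
      constructor <;> nlinarith [h1.1, h1.2, h2.1, h2.2]
    have key : ∀ N : ℕ, 0 < N → |g x| ≤ (4 * L * ‖x‖ ^ 2) / N := by
      intro N hN
      have hNp : (0:ℝ) < N := by exact_mod_cast hN
      have h1 := gb ((N:ℝ)⁻¹ • x)
      rw [gsm, abs_mul, norm_smul, norm_inv, Real.norm_of_nonneg hNp.le, abs_of_pos (by positivity)] at h1
      rw [inv_mul_le_iff₀ hNp] at h1
      refine h1.trans (le_of_eq ?_)
      field_simp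
    have lim : Tendsto (fun N : ℕ => (4 * L * ‖x‖ ^ 2) / N) atTop (𝓝 0) := tendsto_const_div_atTop_nhds_zero_nat _
    have := ge_of_tendsto lim (by filter_upwards [eventually_gt_atTop 0] with N h1 using key N h1)
    have := abs_nonpos_iff.1 this
    simp only [g] at this
    linarith
  let A : Matrix (Fin n) (Fin n) ℝ := Matrix.of fun i j => B (EuclideanSpace.single i 1) (EuclideanSpace.single j 1)
  have hq : v = quadForm A := by
    ext x
    rw [hdiag x]
    unfold quadForm
    congr 1
    have hx : x = ∑ i, x i • (EuclideanSpace.single i 1 : EE n) := by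
      have := (EuclideanSpace.basisFun (Fin n) ℝ).sum_repr x
      simpa using this.symm
    rw [← hBl]
    conv_lhs => rw [hx]
    simp only [map_sum, LinearMap.sum_apply, map_smul, LinearMap.smul_apply, smul_eq_mul, hBl, A, Matrix.of_apply]
    rw [Finset.sum_comm]
    simp only [Finset.mul_sum]
    refine Finset.sum_congr rfl fun i _ => Finset.sum_congr rfl fun j _ => ?_
    ring
  have hH : A.IsHermitian := by
    ext i j
    simp [A, Bsymm (EuclideanSpace.single j 1)]
  refine ⟨A, ⟨?_, ?_⟩, hq⟩
  · refine Matrix.PosSemidef.of_dotProduct_mulVec_nonneg hH fun w => ?_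
    have := hnn (WithLp.toLp 2 w)
    rw [hq] at this
    unfold quadForm at this
    simp only [dotProduct, Matrix.mulVec, star_trivial, Finset.mul_sum]
    have e : ∑ i, ∑ j, A i j * w i * w j = ∑ i, ∑ j, w i * (A i j * w j) :=
      Finset.sum_congr rfl fun i _ => Finset.sum_congr rfl fun j _ => by ring
    simp only at this
    rw [← e]; linarith
  · have hi := (ibp3 (quad_reg hH 0 2) (Reg.one (c := 0) (R := 2))).2
    have h1 := hm 0 1 one_pos
    have hJ := J_one_pos (n := n) 3
    simp only [zero_add, one_smul, hv0, zero_mul, one_pow, mul_one] at h1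
    have e0 : J 3 (fun x => inner ℝ (gradient (quadForm A) x) (gradient (fun _ : EE n => (1:ℝ)) x)) = 0 := by
      simp [J]
    rw [e0] at hi
    simp only [quad_lap hH, quad_euler hH, one_mul, mul_one] at hi
    rw [J_smul] at hi
    have e1 : J 3 (fun _ : EE n => A.trace) = A.trace * J 3 (fun _ : EE n => (1:ℝ)) := by
      rw [← J_smul]; simp
    rw [e1] at hi
    have e2 : J 2 (fun y => v y) = J 2 (fun y => quadForm A y) := by rw [hq]
    rw [e2] at h1
    have : (A.trace - 1) * J 3 (fun _ : EE n => (1:ℝ)) = 0 := by linarith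
    rcases mul_eq_zero.1 this with h | h
    · linarith
    · exact absurd h hJ.ne'


section c1
variable {L : ℝ≥0} {z : EE n} {R : ℝ} {u : EE n → ℝ}

lemma contact_at (h : Sol L z R u) (h0 : u z = 0) (hR : 0 < R) (hL : Low u z R) (x : EE n) {t : ℝ} (ht : 0 < t)
    {ε : ℝ} (hε : 0 < ε) :
    ∃ ρ > 0, ∀ s, 0 < s → s ≤ ρ → Sol L 0 2 (resc (resc u z s) x t) ∧
      |J 3 (fun y => lapGrad (resc (resc u z s) x t) y) - J 3 (fun _ : EE n => (1:ℝ))| ≤ ε := by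
  have hx0 := norm_nonneg x
  set D := 2 * (‖x‖ + t) with hD
  have hDp : 0 < D := by positivity
  have htD : 0 < t / D := by positivity
  have hpow : 0 < (t / D) ^ n := by positivity
  obtain ⟨ρ0, hρ0, hc⟩ := contact_lim h h0 hR hL (ε := 9 / 16 * ((t / D) ^ n * ε)) (by positivity)
  refine ⟨min (ρ0 / D) (R / (2 * D)), by positivity, fun s hs hsr => ?_⟩
  have hs1 : D * s ≤ ρ0 := by
    have := hsr.trans (min_le_left _ _); rw [le_div_iff₀ hDp] at this; linarith
  have hs2 : D * s * 2 ≤ R := by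
    have := hsr.trans (min_le_right _ _); rw [le_div_iff₀ (by positivity)] at this; linarith
  have hDs : 0 < D * s := by positivity
  have hV : Sol L 0 2 (resc u z (D * s)) := h.resc0 hDs hs2
  have e : resc (resc u z (D * s)) (D⁻¹ • x) (t / D) = resc (resc u z s) x t := by
    rw [resc_resc, resc_resc, smul_smul]
    have e1 : D * s * D⁻¹ = s := by field_simp
    have e2 : D * s * (t / D) = s * t := by field_simp
    rw [e1, e2]
  have hxn : ‖D⁻¹ • x‖ = ‖x‖ / D := by rw [norm_smul, norm_inv, Real.norm_of_nonneg hDp.le]; field_simp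
  have hhalf : ‖D⁻¹ • x‖ + t / D = 1 / 2 := by rw [hxn, ← add_div, hD]; field_simp
  have hS : Sol L 0 2 (resc (resc u z s) x t) := by
    rw [← e]
    refine hV.resc htD fun y hy => ?_
    have hy2 : ‖y‖ < 2 := by simpa using hy
    simp only [mem_ball, dist_zero_right]
    have h1 := norm_add_le (D⁻¹ • x) ((t / D) • y)
    rw [norm_smul _ y, Real.norm_of_nonneg htD.le] at h1
    have := norm_nonneg (D⁻¹ • x)
    nlinarith
  refine ⟨hS, ?_⟩
  have k1 := hc (D * s) hDs hs1
  have k2 := contact_vol_half hV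
  have k3 := contact_vol_one hS 3
  have k4 := Kset_scale (resc u z (D * s)) (D⁻¹ • x) htD hhalf.le
  rw [e] at k4
  have k5 : volume.real (Kset (resc u z (D * s)) (1 / 2)) ≤ (t / D) ^ n * ε := by linarith
  have k6 : ((t / D) ^ n)⁻¹ * volume.real (Kset (resc u z (D * s)) (1 / 2)) ≤ ε := by
    rw [inv_mul_le_iff₀ hpow]; exact k5
  rw [abs_le]; constructor <;> linarith [k3.1, k3.2]

end c1

lemma step_avg {L : ℝ≥0} {v : EE n → ℝ} (h : Sol L 0 2 v) {t : ℝ} (ht : 0 ≤ t) (ht' : t ≤ 1 / 2) :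
    |J 2 (fun y => v ((1 + t) • y)) - J 2 v - t / 6 * J 3 (fun y => lapGrad v y)| ≤ L * t ^ 2 * J 2 (fun _ : EE n => (1:ℝ)) := by
  have hi := (ibp3 h.reg (Reg.one (c := 0) (R := 2))).2
  have e0 : J 3 (fun x => inner ℝ (gradient v x) (gradient (fun _ : EE n => (1:ℝ)) x)) = 0 := by
    simp [J]
  rw [e0] at hi
  simp only [one_mul, mul_one] at hi
  have hmem : ∀ y ∈ closedBall (0 : EE n) 1, (1 + t) • y ∈ ball (0 : EE n) 2 := by
    intro y hy
    have hy1 := norm_le_of_cb hy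
    simp only [mem_ball, dist_zero_right, norm_smul]
    rw [Real.norm_of_nonneg (by linarith)]
    nlinarith [norm_nonneg y]
  have c0 : ContinuousOn v (ball 0 2) := h.reg.cont
  have c1 : ContinuousOn (fun y => v ((1 + t) • y)) (closedBall (0 : EE n) 1) :=
    c0.comp (by fun_prop) hmem
  have c2 : ContinuousOn v (closedBall (0 : EE n) 1) := h.v_cont
  have c3 : ContinuousOn (gradient v) (closedBall (0 : EE n) 1) := h.reg.gcont.mono closedBall_sub_ball2
  have c4 : ContinuousOn (fun y => t * inner ℝ y (gradient v y)) (closedBall (0 : EE n) 1) := by fun_prop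
  have e1 : J 2 (fun y => v ((1 + t) • y)) - J 2 v - t / 6 * J 3 (fun y => lapGrad v y)
      = J 2 (fun y => v ((1 + t) • y) - v y - t * inner ℝ y (gradient v y)) := by
    rw [J_sub, J_sub, J_smul]
    · linear_combination (-t / 6) * hi
    · exact JI.of_cont c1
    · exact JI.of_cont c2
    · exact JI.of_cont (c1.sub c2)
    · exact JI.of_cont c4
  rw [e1]
  refine J_abs_le (JI.of_cont ((c1.sub c2).sub c4)) fun y hy => ?_
  have hy1 := norm_le_of_cb hy
  have := h.reg.taylor (closedBall_sub_ball2 hy) (hmem y hy)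
  have e2 : (1 + t) • y - y = t • y := by rw [add_smul, one_smul]; abel
  rw [e2, norm_smul, Real.norm_of_nonneg ht, inner_smul_right, real_inner_comm] at this
  refine this.trans ?_
  have hL : (0:ℝ) ≤ L := L.2
  calc (L:ℝ) * (t * ‖y‖) ^ 2 ≤ L * (t * 1) ^ 2 := by gcongr
    _ = L * t ^ 2 := by ring

lemma mean_id {v : EE n → ℝ} {K : ℝ} (hK : 0 ≤ K) (hc : Continuous v)
    (hs : ∀ x : EE n, ∀ t : ℝ, 0 < t → ∀ h : ℝ, 0 ≤ h → h ≤ 1 / 2 →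
      |J 2 (fun y => v (x + ((1 + h) * t) • y)) - J 2 (fun y => v (x + t • y)) - h * t ^ 2 / 6 * J 3 (fun _ : EE n => (1:ℝ))|
        ≤ K * h ^ 2 * t ^ 2) (x : EE n) (t : ℝ) (ht : 0 < t) :
    J 2 (fun y => v (x + t • y)) = v x * J 2 (fun _ : EE n => (1:ℝ)) + J 3 (fun _ : EE n => (1:ℝ)) / 12 * t ^ 2 := by
  set c := J 3 (fun _ : EE n => (1:ℝ)) with hcd
  have hcp : 0 < c := J_one_pos 3
  set f : ℝ → ℝ := fun t => J 2 (fun y => v (x + t • y)) - c / 12 * t ^ 2 with hf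
  have step : ∀ r, 0 < r → ∀ h, 0 ≤ h → h ≤ 1 / 2 → (1 + h) * r ≤ t → |f ((1 + h) * r) - f r| ≤ (K + c) * t ^ 2 * h ^ 2 := by
    intro r hr h hh hh' hb
    have h1 := hs x r hr h hh hh'
    have hrt : r ≤ t := by nlinarith
    have e : f ((1 + h) * r) - f r = (J 2 (fun y => v (x + ((1 + h) * r) • y)) - J 2 (fun y => v (x + r • y)) - h * r ^ 2 / 6 * c)
        + (- (c / 12 * (h ^ 2 * r ^ 2))) := by
      simp only [hf]; ring
    rw [e]
    refine (abs_add_le _ _).trans ?_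
    have h2 : h ^ 2 * r ^ 2 ≤ h ^ 2 * t ^ 2 := by gcongr
    have h3 : 0 ≤ h ^ 2 * t ^ 2 := by positivity
    have h4 : 0 ≤ c / 12 * (h ^ 2 * r ^ 2) := by positivity
    rw [abs_neg, abs_of_nonneg h4]
    have h5 := mul_le_mul_of_nonneg_left h2 hK
    have h6 := mul_le_mul_of_nonneg_left h2 hcp.le
    have h7 := mul_nonneg hcp.le h3
    nlinarith
  have C0 : 0 ≤ (K + c) * t ^ 2 := by positivity
  have hconst : ∀ r, 0 < r → r ≤ t → f r = f t := by
    intro r hr hrt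
    apply le_antisymm
    · refine mono_of_quad C0 (fun r hr h hh hh' hb => ?_) hr hrt le_rfl
      have := (abs_le.1 (step r hr h hh hh' hb)).1
      linarith
    · have := mono_of_quad (f := fun r => - f r) C0 (fun r hr h hh hh' hb => ?_) hr hrt le_rfl
      · linarith
      · have := (abs_le.1 (step r hr h hh hh' hb)).2
        linarith
  have fc : Continuous f := by
    refine Continuous.sub ?_ (by fun_prop)
    unfold J
    refine continuous_parametric_integral_of_continuous (f := fun (t : ℝ) (y : EE n) => (1 - ‖y‖ ^ 2) ^ 2 * v (x + t • y)) ?_ (isCompact_closedBall _ _)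
    unfold Function.uncurry
    fun_prop
  have lim : Tendsto f (𝓝[>] 0) (𝓝 (f 0)) := (fc.tendsto 0).mono_left nhdsWithin_le_nhds
  have lim2 : Tendsto f (𝓝[>] 0) (𝓝 (f t)) := by
    refine tendsto_const_nhds.congr' ?_
    filter_upwards [Ioc_mem_nhdsGT ht] with r hr
    exact (hconst r hr.1 hr.2).symm
  have e := tendsto_nhds_unique lim lim2
  have e0 : f 0 = v x * J 2 (fun _ : EE n => (1:ℝ)) := by
    simp only [hf]
    rw [← J_smul]; simp
  rw [e0] at e
  simp only [hf] at e
  linarith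


section c2
variable {L : ℝ≥0} {z : EE n} {R : ℝ} {u : EE n → ℝ}

lemma near_of_low (h : Sol L z R u) (h0 : u z = 0) (hR : 0 < R) (hL : Low u z R) :
    ∃ A : Matrix (Fin n) (Fin n) ℝ, MemP A ∧ ∀ ε > 0, ∀ ρ > 0, ∃ r, 0 < r ∧ r < ρ ∧
      ∀ x ∈ closedBall (0 : EE n) 1, |resc u z r x - quadForm A x| ≤ ε := by
  have hL0 : (0:ℝ) ≤ L := L.2
  let U : Ultrafilter ℝ := Ultrafilter.of (𝓝[>] (0:ℝ))
  have hU : (U : Filter ℝ) ≤ 𝓝[>] 0 := Ultrafilter.of_le _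
  have hsmall : ∀ ρ : ℝ, 0 < ρ → ∀ᶠ s in (U : Filter ℝ), 0 < s ∧ s < ρ := fun ρ hρ =>
    hU (by filter_upwards [Ioo_mem_nhdsGT hρ] with s hs using hs)
  have hball : ∀ ρ : ℝ, 0 < ρ → ∀ᶠ s in (U : Filter ℝ), Sol L 0 ρ (resc u z s) := by
    intro ρ hρ
    filter_upwards [hsmall (R / ρ) (by positivity)] with s hs
    refine h.resc0 hs.1 ?_
    have := hs.2; rw [lt_div_iff₀ hρ] at this; exact this.le
  have hin : ∀ (x : EE n) (c : ℝ), ‖x‖ < c → x ∈ ball (0 : EE n) c := fun x c hx => by simpa using hx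
  have hpt : ∀ x : EE n, ∃ a, Tendsto (fun s => resc u z s x) U (𝓝 a) := by
    intro x
    have hev : ∀ᶠ s in (U : Filter ℝ), resc u z s x ∈ Icc (-(L * ‖x‖ ^ 2)) (L * ‖x‖ ^ 2) := by
      filter_upwards [hball (‖x‖ + 1) (by positivity)] with s hs
      exact abs_le.1 (hs.val_le (resc_zero h0 s) (hin x _ (by linarith)))
    obtain ⟨a, -, ha⟩ := (isCompact_Icc (a := -(L * ‖x‖ ^ 2)) (b := L * ‖x‖ ^ 2)).ultrafilter_le_nhds
      (U.map (fun s => resc u z s x)) (by rw [Filter.le_principal_iff]; exact hev)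
    exact ⟨a, ha⟩
  choose v hv using hpt
  have hnn : ∀ x, 0 ≤ v x := by
    intro x
    refine ge_of_tendsto (hv x) ?_
    filter_upwards [hball (‖x‖ + 1) (by positivity)] with s hs
    exact hs.nonneg x (hin x _ (by linarith))
  have hb : ∀ x, |v x| ≤ L * ‖x‖ ^ 2 := by
    intro x
    refine le_of_tendsto (hv x).abs ?_
    filter_upwards [hball (‖x‖ + 1) (by positivity)] with s hs
    exact hs.val_le (resc_zero h0 s) (hin x _ (by linarith))
  have hlip : ∀ ρ : ℝ, 0 < ρ → ∀ x ∈ ball (0 : EE n) ρ, ∀ y ∈ ball (0 : EE n) ρ, |v x - v y| ≤ L * ρ * ‖x - y‖ := by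
    intro ρ hρ x hx y hy
    refine le_of_tendsto ((hv x).sub (hv y)).abs ?_
    filter_upwards [hball ρ hρ] with s hs
    exact hs.lip_val (resc_zero h0 s) hx hy
  have hc : Continuous v := by
    rw [continuous_iff_continuousAt]
    intro x
    have hl : LipschitzOnWith (Real.toNNReal (L * (‖x‖ + 1))) v (ball 0 (‖x‖ + 1)) := by
      refine LipschitzOnWith.of_dist_le_mul fun a ha b hb => ?_
      rw [Real.coe_toNNReal _ (by positivity), Real.dist_eq, dist_eq_norm]
      exact hlip _ (by positivity) a ha b hb
    exact hl.continuousOn.continuousAt (isOpen_ball.mem_nhds (hin x _ (by linarith)))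
  have h2 : ∀ a b : EE n, ∃ C, ∀ x, |v (x + a + b) - v (x + a) - v (x + b) + v x| ≤ C := by
    intro a b
    refine ⟨2 * L * ‖b‖ ^ 2 + L * ‖a‖ * ‖b‖, fun x => ?_⟩
    refine le_of_tendsto ((((hv _).sub (hv _)).sub (hv _)).add (hv _)).abs ?_
    set ρ := ‖x‖ + ‖a‖ + ‖b‖ + 1 with hρ
    filter_upwards [hball ρ (by positivity)] with s hs
    have na := norm_nonneg a
    have nb := norm_nonneg b
    have m1 : x ∈ ball (0 : EE n) ρ := hin _ _ (by linarith)
    have m2 : x + a ∈ ball (0 : EE n) ρ := hin _ _ (by linarith [norm_add_le x a])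
    have m3 : x + b ∈ ball (0 : EE n) ρ := hin _ _ (by linarith [norm_add_le x b])
    have m4 : x + a + b ∈ ball (0 : EE n) ρ := hin _ _ (by linarith [norm_add_le x a, norm_add_le (x + a) b])
    have t1 := hs.reg.taylor m2 m4
    have t2 := hs.reg.taylor m1 m3
    have l1 := hs.reg.lip.dist_le_mul _ m2 _ m1
    rw [add_sub_cancel_left] at t1 t2
    rw [dist_eq_norm, dist_eq_norm, add_sub_cancel_left] at l1
    have i1 := abs_real_inner_le_norm (gradient (resc u z s) (x + a) - gradient (resc u z s) x) b
    rw [inner_sub_left] at i1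
    have i2 : ‖gradient (resc u z s) (x + a) - gradient (resc u z s) x‖ * ‖b‖ ≤ L * ‖a‖ * ‖b‖ := by gcongr
    have i3 := i1.trans i2
    rw [abs_le] at t1 t2 i3 ⊢
    constructor <;> linarith [t1.1, t1.2, t2.1, t2.2, i3.1, i3.2]
  have hunif : ∀ ρ : ℝ, 0 < ρ → ∀ ε : ℝ, 0 < ε → ∀ᶠ s in (U : Filter ℝ), ∀ x ∈ closedBall (0 : EE n) ρ,
      |resc u z s x - v x| ≤ ε := by
    intro ρ hρ ε hε
    set C := L * (ρ + 1) + 1 with hC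
    have hCp : 0 < C := by positivity
    have hd : 0 < ε / (3 * C) := by positivity
    obtain ⟨T, hTs, hTf, hTc⟩ := (isCompact_closedBall (0 : EE n) ρ).finite_cover_balls hd
    have hT : ∀ᶠ s in (U : Filter ℝ), ∀ y ∈ T, |resc u z s y - v y| < ε / 3 := by
      rw [Filter.eventually_all_finite hTf]
      intro y _
      have := (Metric.tendsto_nhds.1 (hv y)) (ε / 3) (by positivity)
      simpa [Real.dist_eq] using this
    filter_upwards [hT, hball (ρ + 1) (by positivity)] with s hs hsol x hx
    have := hTc hx
    simp only [mem_iUnion] at this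
    obtain ⟨y, hy, hxy⟩ := this
    have hx' : x ∈ ball (0 : EE n) (ρ + 1) := closedBall_subset_ball (by linarith) hx
    have hy' : y ∈ ball (0 : EE n) (ρ + 1) := closedBall_subset_ball (by linarith) (hTs hy)
    have k1 := hsol.lip_val (resc_zero h0 s) hx' hy'
    have k2 := hlip (ρ + 1) (by positivity) x hx' y hy'
    have k3 := hs y hy
    have k4 : L * (ρ + 1) * ‖x - y‖ ≤ ε / 3 := by
      have d : ‖x - y‖ ≤ ε / (3 * C) := by
        have := (mem_ball.1 hxy).le; rwa [dist_eq_norm] at this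
      calc L * (ρ + 1) * ‖x - y‖ ≤ C * (ε / (3 * C)) := by
            apply mul_le_mul (by linarith) d (norm_nonneg _) hCp.le
        _ = ε / 3 := by field_simp
    have k5 := k1.trans k4
    have k6 := k2.trans k4
    rw [abs_le] at k5 k6 ⊢
    rw [abs_lt] at k3
    constructor <;> linarith [k5.1, k5.2, k6.1, k6.2, k3.1, k3.2]
  have hM : ∀ (x : EE n) (t : ℝ), 0 < t → Tendsto (fun s => J 2 (fun y => resc u z s (x + t • y))) U
      (𝓝 (J 2 (fun y => v (x + t • y)))) := by
    intro x t ht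
    have hJ := J_one_pos (n := n) 2
    rw [Metric.tendsto_nhds]
    intro ε hε
    have hm : ∀ y ∈ closedBall (0 : EE n) 1, x + t • y ∈ closedBall (0 : EE n) (‖x‖ + t) := by
      intro y hy
      have hy1 := norm_le_of_cb hy
      simp only [mem_closedBall, dist_zero_right]
      have h1 := norm_add_le x (t • y)
      rw [norm_smul, Real.norm_of_nonneg ht.le] at h1
      nlinarith
    filter_upwards [hunif (‖x‖ + t) (by positivity) (ε / (2 * J 2 (fun _ : EE n => (1:ℝ)))) (by positivity),
      hball (‖x‖ + t + 1) (by positivity)] with s hs hsol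
    have c1 : ContinuousOn (fun y => resc u z s (x + t • y)) (closedBall (0 : EE n) 1) := by
      refine hsol.reg.cont.comp (by fun_prop) fun y hy => ?_
      exact closedBall_subset_ball (by linarith) (hm y hy)
    have c2 : ContinuousOn (fun y => v (x + t • y)) (closedBall (0 : EE n) 1) := by fun_prop
    rw [Real.dist_eq, ← J_sub (JI.of_cont c1) (JI.of_cont c2)]
    have := J_abs_le (k := 2) (JI.of_cont (c1.sub c2)) (fun y hy => hs _ (hm y hy))
    refine this.trans_lt ?_
    have e : ε / (2 * J 2 (fun _ : EE n => (1:ℝ))) * J 2 (fun _ : EE n => (1:ℝ)) = ε / 2 := by field_simp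
    rw [e]; linarith
  have hstep : ∀ x : EE n, ∀ t : ℝ, 0 < t → ∀ h : ℝ, 0 ≤ h → h ≤ 1 / 2 →
      |J 2 (fun y => v (x + ((1 + h) * t) • y)) - J 2 (fun y => v (x + t • y)) - h * t ^ 2 / 6 * J 3 (fun _ : EE n => (1:ℝ))|
        ≤ (L * J 2 (fun _ : EE n => (1:ℝ))) * h ^ 2 * t ^ 2 := by
    intro x t ht τ hτ hτ'
    have hl : Tendsto (fun s => J 3 (fun y => lapGrad (resc (resc u z s) x t) y)) U (𝓝 (J 3 (fun _ : EE n => (1:ℝ)))) := by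
      rw [Metric.tendsto_nhds]
      intro ε hε
      obtain ⟨ρ, hρ, hc⟩ := contact_at h h0 hR hL x ht (half_pos hε)
      filter_upwards [hsmall ρ hρ] with s hs
      rw [Real.dist_eq]
      have := (hc s hs.1 hs.2.le).2
      linarith
    refine le_of_tendsto (((hM x _ (by positivity)).sub (hM x t ht)).sub (hl.const_mul (τ * t ^ 2 / 6))).abs ?_
    obtain ⟨ρ, hρ, hc⟩ := contact_at h h0 hR hL x ht one_pos
    filter_upwards [hsmall ρ hρ] with s hs
    have := step_avg (hc s hs.1 hs.2.le).1 hτ hτ'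
    have e1 : ∀ y, resc u z s (x + t • y) = t ^ 2 * resc (resc u z s) x t y := by
      intro y
      rw [show resc (resc u z s) x t y = resc u z s (x + t • y) / t ^ 2 from rfl]; field_simp
    have e2 : ∀ y : EE n, resc u z s (x + ((1 + τ) * t) • y) = t ^ 2 * resc (resc u z s) x t ((1 + τ) • y) := by
      intro y
      rw [← e1, smul_smul, mul_comm t]
    simp only [e1, e2, J_smul]
    have e3 : t ^ 2 * J 2 (fun y => resc (resc u z s) x t ((1 + τ) • y)) - t ^ 2 * J 2 (fun y => resc (resc u z s) x t y)
        - τ * t ^ 2 / 6 * J 3 (fun y => lapGrad (resc (resc u z s) x t) y)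
        = t ^ 2 * (J 2 (fun y => resc (resc u z s) x t ((1 + τ) • y)) - J 2 (resc (resc u z s) x t)
        - τ / 6 * J 3 (fun y => lapGrad (resc (resc u z s) x t) y)) := by
      change _ - t ^ 2 * J 2 (resc (resc u z s) x t) - _ = _
      ring
    rw [e3, abs_mul, abs_of_nonneg (by positivity)]
    calc t ^ 2 * _ ≤ t ^ 2 * (L * τ ^ 2 * J 2 (fun _ : EE n => (1:ℝ))) := by gcongr
      _ = _ := by ring
  have hm := mean_id (mul_nonneg hL0 (J_one_pos (n := n) 2).le) hc hstep
  obtain ⟨A, hA, hvA⟩ := liouville hc hnn hb h2 hm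
  refine ⟨A, hA, fun ε hε ρ hρ => ?_⟩
  obtain ⟨s, hs1, hs2⟩ := ((hsmall ρ hρ).and (hunif 1 one_pos ε hε)).exists
  exact ⟨s, hs1.1, hs1.2, fun x hx => by rw [← hvA]; exact hs2 x hx⟩

end c2


section c3
variable {L : ℝ≥0} {z : EE n} {R : ℝ} {u : EE n → ℝ}

lemma blow_pt {A : Matrix (Fin n) (Fin n) ℝ} (h : IsBlowup u z A) (x : EE n) :
    Tendsto (fun r => resc u z r x) (𝓝[>] 0) (𝓝 (quadForm A x)) := by
  have h1 := (tendstoLocallyUniformly_iff_forall_isCompact.1 h.2) _ (isCompact_singleton (x := x))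
  exact h1.tendsto_at (mem_singleton x)

lemma blow_unique {A B : Matrix (Fin n) (Fin n) ℝ} (hA : IsBlowup u z A) (hB : IsBlowup u z B) : A = B := by
  ext i j
  have := quad_entries hA.1.1.isHermitian hB.1.1.isHermitian (ε := 0) (fun x _ => by
    rw [tendsto_nhds_unique (blow_pt hA x) (blow_pt hB x)]; simp) i j
  rw [mul_zero] at this
  have := abs_nonpos_iff.1 this
  linarith

lemma blow_lip {A : Matrix (Fin n) (Fin n) ℝ} (hA : IsBlowup u z A) (h : Sol L z R u) (h0 : u z = 0) (hR : 0 < R)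
    {x y : EE n} (hx : x ∈ ball (0 : EE n) 1) (hy : y ∈ ball (0 : EE n) 1) :
    |quadForm A x - quadForm A y| ≤ L * ‖x - y‖ := by
  refine le_of_tendsto ((blow_pt hA x).sub (blow_pt hA y)).abs ?_
  filter_upwards [Ioo_mem_nhdsGT hR] with s hs
  have hS : Sol L 0 1 (resc u z s) := h.resc0 hs.1 (by linarith [hs.2])
  simpa using hS.lip_val (resc_zero h0 s) hx hy

lemma cont_local (h : Sol L z R u) (h0 : u z = 0) (hR : 0 < R) (hL : Low u z R) :
    ∃ B : Matrix (Fin n) (Fin n) ℝ, ∀ ε > 0, ∃ δ > 0, ∀ x, dist x z < δ → u x = 0 → Low u x (R / 2) →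
      ∀ A, IsBlowup u x A → ∀ i j, |A i j - B i j| ≤ ε := by
  obtain ⟨B, hB, hn⟩ := near_of_low h h0 hR hL
  have hBb : IsBlowup u z B := blowup_of_near hB h h0 hR hL hn
  refine ⟨B, fun ε hε => ?_⟩
  obtain ⟨η, hη, hsup⟩ := sup_of_L2 n (K := 2 * L) (ε := ε / 48) (by positivity) (by positivity)
  have hJ := J_one_pos (n := n) 1
  obtain ⟨e1, he1, he1η⟩ : ∃ e1 : ℝ, 0 < e1 ∧ (2 * e1) ^ 2 * J 1 (fun _ : EE n => (1:ℝ)) ≤ η := by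
    have : Tendsto (fun e : ℝ => (2 * e) ^ 2 * J 1 (fun _ : EE n => (1:ℝ))) (𝓝[>] 0) (𝓝 ((2 * 0) ^ 2 * J 1 (fun _ : EE n => (1:ℝ)))) :=
      (Continuous.tendsto (by fun_prop) 0).mono_left nhdsWithin_le_nhds
    have h2 := this.eventually (Iic_mem_nhds (by simpa using hη))
    obtain ⟨e, h3, h4⟩ := (h2.and self_mem_nhdsWithin).exists
    exact ⟨e, h4, h3⟩
  obtain ⟨r, hr, hrR, hclose⟩ := hn e1 he1 (R / 6) (by positivity)
  obtain ⟨K, hK⟩ := h.reg.lipschitz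
  refine ⟨min (R / 2) (e1 * r ^ 2 / (K + 1)), by positivity, fun x hx hx0 hxL A hA i j => ?_⟩
  have hxR : dist x z < R / 2 := hx.trans_le (min_le_left _ _)
  have hxK : dist x z < e1 * r ^ 2 / (K + 1) := hx.trans_le (min_le_right _ _)
  have hxS : Sol L x (R / 2) u := h.mono le_rfl (ball_subset_ball' (by linarith))
  have hcl2 : ∀ a ∈ closedBall (0 : EE n) 1, |resc u x r a - quadForm B a| ≤ 2 * e1 := by
    intro a ha
    have h1 := hclose a ha
    have ha1 := norm_le_of_cb ha
    have hra : ‖r • a‖ ≤ r := by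
      rw [norm_smul, Real.norm_of_nonneg hr.le]; nlinarith
    have m1 : x + r • a ∈ ball z R := by
      rw [mem_ball]
      have : dist (x + r • a) x ≤ r := by simpa using hra
      linarith [dist_triangle (x + r • a) x z]
    have m2 : z + r • a ∈ ball z R := by
      rw [mem_ball]
      have : dist (z + r • a) z ≤ r := by simpa using hra
      linarith
    have h2 := hK.dist_le_mul _ m1 _ m2
    rw [dist_add_right, Real.dist_eq] at h2
    have h3 : |resc u x r a - resc u z r a| ≤ e1 := by
      unfold resc
      rw [← sub_div, abs_div, abs_of_pos (show 0 < r ^ 2 by positivity), div_le_iff₀ (by positivity)]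
      refine h2.trans ?_
      rw [lt_div_iff₀ (by positivity)] at hxK
      nlinarith [dist_nonneg (x := x) (y := z)]
    rw [abs_le] at h1 h3 ⊢
    constructor <;> linarith [h1.1, h1.2, h3.1, h3.2]
  have c1 : ContinuousOn (resc u x r) (closedBall 0 1) :=
    (hxS.resc0 (R' := 2) hr (by linarith)).v_cont
  have c2 := (quad_cont B)
  have c3 := (quad_cont A)
  have d := blow_dist hA hB hxS hx0 hxL hr (by linarith)
  have d2 : J 1 (fun a => (resc u x r a - quadForm B a) ^ 2) ≤ (2 * e1) ^ 2 * J 1 (fun _ : EE n => (1:ℝ)) := by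
    refine (le_abs_self _).trans (J_abs_le (JI.of_cont (by fun_prop)) fun a ha => ?_)
    rw [abs_of_nonneg (sq_nonneg _), sq_le_sq, abs_of_pos (show 0 < 2 * e1 by positivity)]
    exact hcl2 a ha
  have key := hsup (fun a => quadForm A a - quadForm B a) (by fun_prop) (fun a ha b hb => by
    have k1 := blow_lip hA hxS hx0 (by positivity) ha hb
    have k2 := blow_lip hBb h h0 hR ha hb
    rw [abs_le] at k1 k2 ⊢
    constructor <;> linarith [k1.1, k1.2, k2.1, k2.2]) (d.trans (d2.trans he1η))
  have := quad_entries hA.1.1.isHermitian hB.1.isHermitian key i j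
  linarith

end c3

section c4
variable {Ω : Set (EE n)} {u : EE n → ℝ}

lemma sol_at (hΩ : IsOpen Ω) (hu : IsObstacleSol Ω u) {y : EE n} (hy : y ∈ Ω) :
    ∃ (L : ℝ≥0) (R : ℝ), 0 < R ∧ Sol L y R u := by
  obtain ⟨R, hR, hb⟩ := Metric.nhds_basis_closedBall.mem_iff.1 (hΩ.mem_nhds hy)
  obtain ⟨L, hL⟩ := hu.2.1 _ hb (isCompact_closedBall _ _)
  refine ⟨L, R, hR, ⟨fun x hx => hu.1 x (hb (ball_subset_closedBall hx)), hL.mono ball_subset_closedBall⟩,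
    fun x hx => hu.2.2.1 x (hb (ball_subset_closedBall hx)), ?_⟩
  have := hu.2.2.2
  rw [ae_restrict_iff' hΩ.measurableSet] at this
  filter_upwards [this] with x hx hxb using hx (hb (ball_subset_closedBall hxb))

lemma sing_zero (hΩ : IsOpen Ω) (hu : IsObstacleSol Ω u) {x : EE n} (hx : IsSingularPt Ω u x) : x ∈ Ω ∧ u x = 0 := by
  have hxΩ : x ∈ Ω := hx.1.2
  refine ⟨hxΩ, le_antisymm ?_ (hu.2.2.1 x hxΩ)⟩
  by_contra hc
  have hcont : ContinuousOn u Ω := fun y hy => (hu.1 y hy).continuousAt.continuousWithinAt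
  have ho : IsOpen {x | x ∈ Ω ∧ 0 < u x} := hcont.isOpen_inter_preimage hΩ isOpen_Ioi
  have h1 := hx.1.1
  rw [ho.frontier_eq] at h1
  exact h1.2 ⟨hxΩ, not_le.1 hc⟩

lemma sing_near {x : EE n} (hx : IsSingularPt Ω u x) : ∃ A, MemP A ∧ ∀ ε > 0, ∀ ρ > 0, ∃ r, 0 < r ∧ r < ρ ∧
      ∀ a ∈ closedBall (0 : EE n) 1, |resc u x r a - quadForm A a| ≤ ε := by
  obtain ⟨-, r, A, hr, hr0, hA, hlim⟩ := hx
  refine ⟨A, hA, fun ε hε ρ hρ => ?_⟩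
  have h1 := (tendstoLocallyUniformly_iff_forall_isCompact.1 hlim) _ (isCompact_closedBall (0 : EE n) 1)
  rw [Metric.tendstoUniformlyOn_iff] at h1
  obtain ⟨k, hk, hk2⟩ := ((h1 ε hε).and (hr0.eventually (Iio_mem_nhds hρ))).exists
  refine ⟨r k, hr k, hk2, fun a ha => ?_⟩
  have := (hk a ha).le
  rw [dist_comm, Real.dist_eq] at this
  exact this

lemma sing_low {x : EE n} (hx : IsSingularPt Ω u x) {L : ℝ≥0} {R : ℝ} (h : Sol L x R u) (h0 : u x = 0) : Low u x R := by
  obtain ⟨A, hA, hn⟩ := sing_near hx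
  refine Low_of_near h h0 fun ε hε ρ hρ => ?_
  obtain ⟨r, h1, h2, h3⟩ := hn ε hε ρ hρ
  exact ⟨r, h1, h2, A, hA, h3⟩

lemma sing_blow (hΩ : IsOpen Ω) (hu : IsObstacleSol Ω u) {x : EE n} (hx : IsSingularPt Ω u x) : ∃ A, IsBlowup u x A := by
  obtain ⟨hxΩ, h0⟩ := sing_zero hΩ hu hx
  obtain ⟨L, R, hR, h⟩ := sol_at hΩ hu hxΩ
  obtain ⟨A, hA, hn⟩ := sing_near hx
  exact ⟨A, blowup_of_near hA h h0 hR (sing_low hx h h0) hn⟩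

lemma sing_cont (hΩ : IsOpen Ω) (hu : IsObstacleSol Ω u) {Am : EE n → Matrix (Fin n) (Fin n) ℝ}
    (hAm : ∀ y, IsSingularPt Ω u y → IsBlowup u y (Am y)) {y : EE n} (hy : y ∈ Ω) {ε : ℝ} (hε : 0 < ε) :
    ∃ δ > 0, ∀ x, IsSingularPt Ω u x → dist x y < δ → ∀ x', IsSingularPt Ω u x' → dist x' y < δ →
      ∀ i j, |Am x i j - Am x' i j| ≤ ε := by
  obtain ⟨L, R, hR, h⟩ := sol_at hΩ hu hy
  by_cases hcl : ∀ δ > 0, ∃ x, IsSingularPt Ω u x ∧ dist x y < δ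
  swap
  · push Not at hcl
    obtain ⟨δ, hδ, hh⟩ := hcl
    exact ⟨δ, hδ, fun x hx hd => absurd hd (not_lt.2 (hh x hx))⟩
  have h0 : u y = 0 := by
    have hc : ContinuousAt u y := (hu.1 y hy).continuousAt
    have hmem : y ∈ closure {x | IsSingularPt Ω u x} := by
      rw [Metric.mem_closure_iff]
      intro δ hδ
      obtain ⟨x, h1, h2⟩ := hcl δ hδ
      exact ⟨x, h1, by rwa [dist_comm]⟩
    have hne := mem_closure_iff_nhdsWithin_neBot.1 hmem
    have l1 : Tendsto u (𝓝[{x | IsSingularPt Ω u x}] y) (𝓝 (u y)) := hc.mono_left nhdsWithin_le_nhds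
    have l2 : Tendsto u (𝓝[{x | IsSingularPt Ω u x}] y) (𝓝 0) := by
      refine tendsto_const_nhds.congr' ?_
      filter_upwards [self_mem_nhdsWithin] with x hx
      exact (sing_zero hΩ hu hx).2.symm
    exact tendsto_nhds_unique l1 l2
  have hlow : ∀ R' : ℝ, 0 < R' → R' ≤ R / 2 → ∀ x, IsSingularPt Ω u x → dist x y < R / 2 → Low u x R' := by
    intro R' hR' hR'' x hx hd
    exact sing_low hx (h.mono le_rfl (ball_subset_ball' (by linarith))) (sing_zero hΩ hu hx).2
  have hLy : Low u y (R / 2) := by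
    refine Low_closed h fun δ hδ => ?_
    obtain ⟨x, hx, hd⟩ := hcl (min δ (R / 2)) (by positivity)
    exact ⟨x, hd.trans_le (min_le_left _ _), (sing_zero hΩ hu hx).2,
      hlow _ (by positivity) le_rfl x hx (hd.trans_le (min_le_right _ _))⟩
  obtain ⟨B, hB⟩ := cont_local (h.mono le_rfl (ball_subset_ball (by linarith)) : Sol L y (R / 2) u) h0 (by positivity) hLy
  obtain ⟨δ, hδ, hh⟩ := hB (ε / 2) (by positivity)
  have one : ∀ x, IsSingularPt Ω u x → dist x y < min δ (R / 2) → ∀ i j, |Am x i j - B i j| ≤ ε / 2 := by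
    intro x hx hd
    exact hh x (hd.trans_le (min_le_left _ _)) (sing_zero hΩ hu hx).2
      (hlow _ (by positivity) (by linarith) x hx (hd.trans_le (min_le_right _ _))) _ (hAm x hx)
  refine ⟨min δ (R / 2), by positivity, fun x hx hd x' hx' hd' i j => ?_⟩
  have k1 := one x hx hd i j
  have k2 := one x' hx' hd' i j
  rw [abs_le] at k1 k2 ⊢
  constructor <;> linarith [k1.1, k1.2, k2.1, k2.2]

end c4

theorem final_aux
    {n : ℕ}
    (Ω : Set (EuclideanSpace ℝ (Fin n))) (hΩopen : IsOpen Ω)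
    (u : EuclideanSpace ℝ (Fin n) → ℝ) (hu : IsObstacleSol Ω u)
    (x0 : EuclideanSpace ℝ (Fin n)) (hx0 : IsSingularPt Ω u x0) :
    (∃! A : Matrix (Fin n) (Fin n) ℝ, IsBlowup u x0 A) ∧
    ∃ Amap : EuclideanSpace ℝ (Fin n) → Matrix (Fin n) (Fin n) ℝ,
      (∀ y, IsSingularPt Ω u y → IsBlowup u y (Amap y)) ∧
      ∀ y, IsSingularPt Ω u y → ∃ δ : ℝ, 0 < δ ∧
        UniformContinuousOn Amap ({z | IsSingularPt Ω u z} ∩ ball y δ) := by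
  constructor
  · obtain ⟨A, hA⟩ := sing_blow hΩopen hu hx0
    exact ⟨A, hA, fun B hB => blow_unique hB hA⟩
  have hex : ∀ y, ∃ A : Matrix (Fin n) (Fin n) ℝ, IsSingularPt Ω u y → IsBlowup u y A := by
    intro y
    by_cases hy : IsSingularPt Ω u y
    · obtain ⟨A, hA⟩ := sing_blow hΩopen hu hy
      exact ⟨A, fun _ => hA⟩
    · exact ⟨0, fun h => absurd h hy⟩
  choose Am hAm using hex
  refine ⟨Am, hAm, fun y hy => ?_⟩
  obtain ⟨δ, hδ, hb⟩ := Metric.nhds_basis_closedBall.mem_iff.1 (hΩopen.mem_nhds (sing_zero hΩopen hu hy).1)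
  refine ⟨δ, hδ, ?_⟩
  rw [uniformContinuousOn_iff_restrict, Matrix.uniformContinuous]
  intro i j
  rw [Metric.uniformContinuous_iff]
  intro ε hε
  have hloc := fun (p : closedBall y δ) => sing_cont hΩopen hu hAm (hb p.2) (half_pos hε)
  choose d hd hdd using hloc
  obtain ⟨r, hr, hcov⟩ := lebesgue_number_lemma_of_metric (c := fun p : closedBall y δ => ball (p : EE n) (d p))
    (isCompact_closedBall y δ) (fun p => isOpen_ball) (fun p hp => mem_iUnion.2 ⟨⟨p, hp⟩, mem_ball_self (hd _)⟩)
  refine ⟨r, hr, fun a b hab => ?_⟩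
  obtain ⟨p, hp⟩ := hcov a (ball_subset_closedBall a.2.2)
  have ha := hp (mem_ball_self hr)
  have hb' : (b : EE n) ∈ ball (p : EE n) (d p) := hp (by rw [mem_ball, dist_comm]; exact hab)
  have := hdd p a a.2.1 ha b b.2.1 hb' i j
  rw [Real.dist_eq]
  simp only [domRestrict_apply]
  linarith


end helpers


/-- Uniqueness and continuity of blow-ups at singular points:
at every singular point `x0` there is a unique `p_{*,x0} ∈ 𝒫` (equivalently, a
unique symmetric nonnegative-definite coefficient matrix `A_{x0}` of trace `1`)
such that `u(x0 + r x)/r² → p_{*,x0}(x)` locally uniformly as `r → 0⁺` (full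
limit), and the map `Σ ∋ x0 ↦ A_{x0}` is locally uniformly continuous on the
singular set `Σ`. -/
theorem blowup_unique_and_continuous_at_singular_points
    {n : ℕ} (hn : 2 ≤ n)
    (Ω : Set (EuclideanSpace ℝ (Fin n))) (hΩopen : IsOpen Ω)
    (u : EuclideanSpace ℝ (Fin n) → ℝ) (hu : IsObstacleSol Ω u)
    (x0 : EuclideanSpace ℝ (Fin n)) (hx0 : IsSingularPt Ω u x0) :
    (∃! A : Matrix (Fin n) (Fin n) ℝ, IsBlowup u x0 A) ∧
    ∃ Amap : EuclideanSpace ℝ (Fin n) → Matrix (Fin n) (Fin n) ℝ,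
      (∀ y, IsSingularPt Ω u y → IsBlowup u y (Amap y)) ∧
      ∀ y, IsSingularPt Ω u y → ∃ δ : ℝ, 0 < δ ∧
        UniformContinuousOn Amap ({z | IsSingularPt Ω u z} ∩ ball y δ) := by
  exact final_aux Ω hΩopen u hu x0 hx0
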